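/- Let P ⊂ ℝⁿ be a lattice polytope of dimension n and let r be the largest positive integer such that rP contains no interior lattice points. Then the polytopal semigroup ring k[S_{(n-r)P}] associated to the dilation (n-r)P is Koszul. -/

import Mathlib

open Pointwise

/-- `R` with grading `𝒜` is Koszul: the residue field `k = R/R₊` admits a linear free
resolution over `R`. -/
def IsKoszul {k R : Type} [Field k] [CommRing R] [Algebra k R]
    (𝒜 : ℕ → Submodule k R) : Prop :=
  ∃ (ι : ℕ → Type) (d : ∀ i : ℕ, ((ι (i+1)) →₀ R) →ₗ[R] ((ι i) →₀ R))
    (ε : ((ι 0) →₀ R) →ₗ[R] (R ⧸ (Ideal.span (⋃ n ∈ {n : ℕ | 0 < n}, ((𝒜 n : Submodule k R) : Set R))))),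
    Function.Surjective ε ∧
    LinearMap.ker ε = LinearMap.range (d 0) ∧
    (∀ i, LinearMap.ker (d i) = LinearMap.range (d (i+1))) ∧
    (∀ i (b : ι (i+1)) (a : ι i), (d i (Finsupp.single b 1)) a ∈ 𝒜 1)

/-- The semigroup `S_Q ⊆ ℤⁿ × ℤ` of a lattice polytope `Q ⊆ ℝⁿ`, generated by
`{(p, 1) : p ∈ Q ∩ ℤⁿ}`. -/
def polytopeSemigroup (n : ℕ) (Q : Set (Fin n → ℝ)) :
    AddSubmonoid ((Fin n → ℤ) × ℤ) :=
  AddSubmonoid.closure {q : (Fin n → ℤ) × ℤ |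
    (fun i => ((q.1 i : ℝ))) ∈ Q ∧ q.2 = 1}

section Koszul

variable {V : Type} [LinearOrder V]

/-- The sign of the position of `v` relative to the elements of `F`. -/
def koszulSign (v : V) (F : Finset V) : ℤ := (-1) ^ (F.filter (· < v)).card

theorem koszulSign_mul_self (v : V) (F : Finset V) : koszulSign v F * koszulSign v F = 1 := by
  rw [koszulSign, ← mul_pow]; simp

theorem koszulSign_insert_of_lt {u v : V} {F : Finset V} (h : u < v) (hu : u ∉ F) :
    koszulSign v (insert u F) = -koszulSign v F := by
  rw [koszulSign, koszulSign, Finset.filter_insert, if_pos h, Finset.card_insert_of_notMem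
    (by simp [hu]), pow_succ]
  ring

theorem koszulSign_insert_of_not_lt {u v : V} {F : Finset V} (h : ¬ u < v) :
    koszulSign v (insert u F) = koszulSign v F := by
  rw [koszulSign, koszulSign, Finset.filter_insert, if_neg h]

theorem koszulSign_mul_swap {u v : V} {F : Finset V} (huv : u ≠ v) (hu : u ∉ F) (hv : v ∉ F) :
    koszulSign v F * koszulSign u (insert v F) = -(koszulSign u F * koszulSign v (insert u F)) := by
  rcases lt_or_gt_of_ne huv with h | h
  · rw [koszulSign_insert_of_lt h hu, koszulSign_insert_of_not_lt h.not_gt]; ring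
  · rw [koszulSign_insert_of_lt h hv, koszulSign_insert_of_not_lt h.not_gt]; ring

variable [Fintype V] {L X Y : Type*} [CommRing L] [AddCommGroup X] [Module L X] [AddCommGroup Y]
  [Module L Y]

/-- The differential of the Koszul complex of the commuting operators `x v` on `X`; a chain is
given by its coefficients with respect to the standard basis of the exterior algebra. -/
def koszulBoundary (x : V → L) : (Finset V → X) →ₗ[L] (Finset V → X) where
  toFun z G := ∑ v ∈ Gᶜ, koszulSign v G • x v • z (insert v G)
  map_add' y z := by
    funext G
    simp [Finset.sum_add_distrib]
  map_smul' c z := by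
    funext G
    simp only [Pi.smul_apply, RingHom.id_apply, Finset.smul_sum]
    refine Finset.sum_congr rfl fun v _ => ?_
    rw [smul_comm c (koszulSign v G), smul_comm c (x v)]

theorem koszulBoundary_apply (x : V → L) (z : Finset V → X) (G : Finset V) :
    koszulBoundary x z G = ∑ v ∈ Gᶜ, koszulSign v G • x v • z (insert v G) := rfl

theorem koszulBoundary_comp (x : V → L) (z : Finset V → X) :
    koszulBoundary x (koszulBoundary x z) = 0 := by
  funext G
  simp only [koszulBoundary_apply, Finset.smul_sum, Pi.zero_apply]
  rw [Finset.sum_sigma']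
  refine Finset.sum_involution (fun p _ => ⟨p.2, p.1⟩) ?_ ?_ ?_ ?_
  · rintro ⟨v, u⟩ h
    simp only [Finset.mem_sigma, Finset.mem_compl, Finset.mem_insert, not_or] at h
    obtain ⟨hv, huv, hu⟩ := h
    simp only
    rw [smul_comm (x v) (koszulSign u (insert v G)), smul_smul, smul_smul (x v),
      smul_comm (x u) (koszulSign v (insert u G)), smul_smul (koszulSign u G), smul_smul (x u),
      koszulSign_mul_swap huv hu hv, Finset.insert_comm, mul_comm (x v), neg_smul, neg_add_cancel]
  · rintro ⟨v, u⟩ h _ heq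
    simp only [Finset.mem_sigma, Finset.mem_compl, Finset.mem_insert, not_or] at h
    exact h.2.1 (congrArg Sigma.fst heq)
  · rintro ⟨v, u⟩ h
    simp only [Finset.mem_sigma, Finset.mem_compl, Finset.mem_insert, not_or] at h ⊢
    exact ⟨h.2.2, fun e => h.2.1 e.symm, h.1⟩
  · rintro ⟨v, u⟩ h
    rfl

theorem koszulBoundary_map (x : V → L) (f : X →ₗ[L] Y) (z : Finset V → X) :
    koszulBoundary x (fun F => f (z F)) = fun G => f (koszulBoundary x z G) := by
  funext G
  simp [koszulBoundary_apply, map_sum]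

/-- An abstract acyclic matching: if the cells of dimension `i` are matched along `D` up to
lower order terms, then `i`-cycles supported on cells are boundaries. -/
theorem exists_koszulBoundary_eq_of_matching {k : Type*} [CommRing k] (cell : Finset V → Prop)
    (wt : Finset V → ℝ) (D : Finset V → Finset V)
    (hcell : ∀ G v, v ∉ G → cell (insert v G) → cell G)
    (hle : ∀ G v, v ∉ G → cell (insert v G) → wt G ≤ wt (insert v G))
    (heq : ∀ G v, v ∉ G → cell (insert v G) → wt G = wt (insert v G) → D G = D (insert v G))
    (hup : ∀ F v, cell F → v ∈ D F → v ∉ F → cell (insert v F) ∧ wt (insert v F) = wt F)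
    (hdown : ∀ F v, cell F → v ∈ D F → v ∈ F → wt (F.erase v) = wt F)
    (i : ℕ) (hD : ∀ F, cell F → F.card = i → (D F).Nonempty)
    (z : Finset V → k) (hz : ∀ F, z F ≠ 0 → cell F ∧ F.card = i)
    (hcyc : koszulBoundary (fun _ => (1 : k)) z = 0) :
    ∃ y : Finset V → k, (∀ F, y F ≠ 0 → cell F ∧ F.card = i + 1) ∧
      koszulBoundary (fun _ => (1 : k)) y = z := by
  classical
  obtain ⟨p, hp⟩ : ∃ p : Finset V → Option V, ∀ s, s.Nonempty → ∃ v ∈ s, p s = some v := by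
    refine ⟨fun s => if h : s.Nonempty then some h.choose else none, fun s hs => ?_⟩
    exact ⟨hs.choose, hs.choose_spec, by simp [hs]⟩
  set lower : Finset V → Prop := fun F => ∃ v ∈ F, v ∈ D F ∧ p (D F) = some v with hlower
  -- `Q z`: modulo boundaries, `z` is a combination of lower cells
  set Q : (Finset V → k) → Prop := fun z => ∃ y : Finset V → k,
    (∀ G, y G ≠ 0 → cell G ∧ G.card = i + 1) ∧
      ∀ G, (z - koszulBoundary (fun _ => (1 : k)) y) G ≠ 0 → cell G ∧ G.card = i ∧ lower G with hQ
  have Qsmul : ∀ (c : k) (z : Finset V → k), Q z → Q (c • z) := by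
    rintro c z ⟨y, hy, hy'⟩
    refine ⟨c • y, fun H hH => hy H fun h => hH (by simp [h]), fun H hH => hy' H fun h => hH ?_⟩
    rw [map_smul, ← smul_sub, Pi.smul_apply, h, smul_zero]
  have Qsum : ∀ f : Finset V → Finset V → k, (∀ G, Q (f G)) → Q (∑ G, f G) := by
    intro f hf
    choose Y hY1 hY2 using hf
    refine ⟨∑ G, Y G, fun G hG => ?_, fun G hG => ?_⟩
    · rw [Finset.sum_apply] at hG
      obtain ⟨H, -, hH⟩ := Finset.exists_ne_zero_of_sum_ne_zero hG
      exact hY1 H G hH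
    · rw [map_sum, ← Finset.sum_sub_distrib, Finset.sum_apply] at hG
      obtain ⟨H, -, hH⟩ := Finset.exists_ne_zero_of_sum_ne_zero hG
      exact hY2 H G hH
  have Qcomb : ∀ u : Finset V → k, (∀ G, u G ≠ 0 → Q (Pi.single G 1)) → Q u := by
    intro u hu
    rw [← Finset.univ_sum_single u]
    refine Qsum _ fun G => ?_
    have : (Pi.single G (u G) : Finset V → k) = u G • Pi.single G 1 := by
      rw [← Pi.single_smul]; simp
    rw [this]
    by_cases h0 : u G = 0
    · rw [h0, zero_smul]
      exact ⟨0, by simp, by simp⟩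
    · exact Qsmul _ _ (hu G h0)
  have Qlower : ∀ F, cell F → F.card = i → lower F → Q (Pi.single F 1) := by
    intro F hF hFi hlow
    refine ⟨0, by simp, fun G hG => ?_⟩
    rw [map_zero, sub_zero] at hG
    have : G = F := by
      by_contra h
      exact hG (Pi.single_eq_of_ne h _)
    subst this
    exact ⟨hF, hFi, hlow⟩
  have key : ∀ F, cell F → F.card = i → Q (Pi.single F 1) := by
    have wf : WellFounded (fun F G : Finset V => wt F < wt G) :=
      letI : IsTrans (Finset V) (fun F G => wt F < wt G) := ⟨fun _ _ _ => lt_trans⟩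
      letI : Std.Irrefl (fun F G : Finset V => wt F < wt G) := ⟨fun _ => lt_irrefl _⟩
      Finite.wellFounded_of_trans_of_irrefl _
    intro F
    induction F using wf.induction with
    | _ F ih =>
    intro hF hFi
    by_cases hlow : lower F
    · exact Qlower F hF hFi hlow
    obtain ⟨b, hb, hpb⟩ := hp _ (hD F hF hFi)
    have hbF : b ∉ F := fun h => hlow ⟨b, h, hb, hpb⟩
    obtain ⟨hcb, hwb⟩ := hup F b hF hb hbF
    have hDb : D F = D (insert b F) := heq F b hbF hcb hwb.symm
    set y0 : Finset V → k := Pi.single (insert b F) ((koszulSign b F : ℤ) : k) with hy0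
    set e : Finset V → k := Pi.single F 1 - koszulBoundary (fun _ => (1 : k)) y0 with he
    have hcard : (insert b F).card = i + 1 := by rw [Finset.card_insert_of_notMem hbF, hFi]
    have hy0' : ∀ G, y0 G ≠ 0 → G = insert b F := fun G hG => by
      by_contra h
      exact hG (Pi.single_eq_of_ne h _)
    have heF : e F = 0 := by
      rw [he, Pi.sub_apply, Pi.single_eq_same, koszulBoundary_apply,
        Finset.sum_eq_single_of_mem b (by simpa using hbF)]
      · rw [hy0, Pi.single_eq_same]
        simp only [smul_eq_mul, zsmul_eq_mul, one_mul]
        rw [← Int.cast_mul, koszulSign_mul_self]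
        simp
      · intro v hv hvb
        have : y0 (insert v F) = 0 := by
          by_contra h
          have h1 := hy0' _ h
          have : v ∈ insert b F := h1 ▸ Finset.mem_insert_self v F
          rcases Finset.mem_insert.1 this with h | h
          · exact hvb h
          · exact (Finset.mem_compl.1 hv) h
        rw [this]; simp
    have hesupp : ∀ G, e G ≠ 0 → cell G ∧ G.card = i ∧ (lower G ∨ wt G < wt F) := by
      intro G hG
      have hGF : G ≠ F := fun h => hG (h ▸ heF)
      have : koszulBoundary (fun _ => (1 : k)) y0 G ≠ 0 := by
        intro h
        apply hG
        rw [he, Pi.sub_apply, h, Pi.single_eq_of_ne hGF, sub_zero]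
      rw [koszulBoundary_apply] at this
      obtain ⟨v, hv, hne⟩ := Finset.exists_ne_zero_of_sum_ne_zero this
      have hyv : y0 (insert v G) ≠ 0 := fun h => hne (by rw [h]; simp)
      have hins := hy0' _ hyv
      have hvG : v ∉ G := by simpa using hv
      have hcG := hcell G v hvG (hins ▸ hcb)
      have hGc : G.card = i := by
        have := Finset.card_insert_of_notMem hvG
        rw [hins, hcard] at this
        omega
      refine ⟨hcG, hGc, ?_⟩
      have hw := hle G v hvG (hins ▸ hcb)
      rw [hins, hwb] at hw
      rcases hw.lt_or_eq with h | h
      · exact Or.inr h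
      · left
        have hDG := heq G v hvG (hins ▸ hcb) (by rw [hins, hwb, h])
        rw [hins, ← hDb] at hDG
        refine ⟨b, ?_, hDG ▸ hb, hDG ▸ hpb⟩
        have hbi : b ∈ insert v G := hins ▸ Finset.mem_insert_self b F
        rcases Finset.mem_insert.1 hbi with h' | h'
        · exfalso
          subst h'
          apply hGF
          rw [← Finset.erase_insert hvG, hins, Finset.erase_insert hbF]
        · exact h'
    obtain ⟨y, hy, hy'⟩ : Q e := by
      refine Qcomb e fun G hG => ?_
      obtain ⟨h1, h2, h3⟩ := hesupp G hG
      exact h3.elim (Qlower G h1 h2) fun h3 => ih G h3 h1 h2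
    refine ⟨y0 + y, fun G hG => ?_, fun G hG => ?_⟩
    · by_cases h0 : y0 G = 0
      · rw [Pi.add_apply, h0, zero_add] at hG
        exact hy G hG
      · rw [hy0' G h0]
        exact ⟨hcb, hcard⟩
    · rw [map_add, ← sub_sub] at hG
      exact hy' G hG
  -- a cycle that only involves lower cells vanishes
  have hzero : ∀ u : Finset V → k, (∀ F, u F ≠ 0 → cell F ∧ F.card = i ∧ lower F) →
      koszulBoundary (fun _ => (1 : k)) u = 0 → u = 0 := by
    intro u hu hcu
    by_contra hne
    obtain ⟨F0, hF0⟩ := Function.ne_iff.1 hne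
    obtain ⟨F, hF, hmax⟩ := Finset.exists_max_image (Finset.univ.filter fun F => u F ≠ 0) wt
      ⟨F0, by simpa using hF0⟩
    have hF' : u F ≠ 0 := by simpa using hF
    obtain ⟨hcF, hFi, b, hbF, hbD, hpb⟩ := hu F hF'
    have hins : insert b (F.erase b) = F := Finset.insert_erase hbF
    have hbe : b ∉ F.erase b := Finset.notMem_erase b F
    have hwF := hdown F b hcF hbD hbF
    have hDF : D (F.erase b) = D F := by
      have := heq (F.erase b) b hbe (hins.symm ▸ hcF) (by rw [hins, hwF])
      rwa [hins] at this
    have h0 := congrFun hcu (F.erase b)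
    rw [koszulBoundary_apply, Finset.sum_eq_single_of_mem b (by simp), hins] at h0
    · apply hF'
      have h1 := congrArg (fun c : k => koszulSign b (F.erase b) • c) h0
      simp only [one_smul, Pi.zero_apply, smul_zero] at h1
      rwa [smul_smul, koszulSign_mul_self, one_smul] at h1
    · intro v hv hvb
      have hve : v ∉ F.erase b := Finset.mem_compl.1 hv
      by_contra hne'
      have huv : u (insert v (F.erase b)) ≠ 0 := fun h => hne' (by rw [h]; simp)
      obtain ⟨hc', -, b', hb', hbD', hpb'⟩ := hu _ huv
      have hw1 := hle _ v hve hc'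
      have hw2 := hmax (insert v (F.erase b)) (by simpa using huv)
      have hD' := heq _ v hve hc' (le_antisymm hw1 (by rw [hwF]; exact hw2))
      rw [← hD', hDF, hpb] at hpb'
      obtain rfl : b = b' := by simpa using hpb'
      rcases Finset.mem_insert.1 hb' with h | h
      · exact hvb h.symm
      · exact hbe h
  obtain ⟨y, hy, hy'⟩ : Q z := Qcomb z fun G hG => key G (hz G hG).1 (hz G hG).2
  refine ⟨y, hy, (sub_eq_zero.1 (hzero _ hy' ?_)).symm⟩
  rw [map_sub, hcyc, koszulBoundary_comp, sub_zero]

end Koszul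
section Regularity

variable {k L V : Type} [Field k] [CommRing L] [Algebra k L] [Fintype V] [LinearOrder V]

/-- Castelnuovo-Mumford regularity at most `c`, formulated through the vanishing of Koszul
homology of the operators `x v` on the graded pieces `N m`, `m ≥ c`. -/
def KoszulRegular {X : Type} [AddCommGroup X] [Module L X] [Module k X]
    (x : V → L) (N : ℕ → Submodule k X) (c : ℕ) : Prop :=
  ∀ m, c ≤ m → ∀ z : Finset V → X, (∀ F, z F ∈ N (m + 1)) → koszulBoundary x z = 0 →
    ∃ y : Finset V → X, (∀ F, y F ∈ N m) ∧ koszulBoundary x y = z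

/-- Finitely supported families of elements of degree `m`. -/
def finsuppPiece (A : ℕ → Submodule k L) (ι : Type) (m : ℕ) : Submodule k (ι →₀ L) where
  carrier := {f | ∀ b, f b ∈ A m}
  zero_mem' _ := (A m).zero_mem
  add_mem' hf hg b := (A m).add_mem (hf b) (hg b)
  smul_mem' c _ hf b := (A m).smul_mem c (hf b)

theorem koszulBoundary_mem {X : Type} [AddCommGroup X] [Module L X] [Module k X]
    {A : ℕ → Submodule k L} {x : V → L} (hx : ∀ v, x v ∈ A 1) {N : ℕ → Submodule k X}
    (hN : ∀ m, ∀ a ∈ A 1, ∀ f ∈ N m, a • f ∈ N (m + 1)) {m : ℕ} {y : Finset V → X}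
    (hy : ∀ F, y F ∈ N m) (F : Finset V) : koszulBoundary x y F ∈ N (m + 1) :=
  Submodule.sum_mem _ fun v _ => zsmul_mem (hN m _ (hx v) _ (hy _)) _

theorem KoszulRegular.finsuppPiece {A : ℕ → Submodule k L} {x : V → L} {d : ℕ}
    (hreg : KoszulRegular x A d) (ι : Type) : KoszulRegular x (finsuppPiece A ι) d := by
  classical
  intro m hm z hz hcyc
  have hb : ∀ b, ∃ y : Finset V → L, (∀ F, y F ∈ A m) ∧
      koszulBoundary x y = (fun F => z F b) ∧ ((∀ F, z F b = 0) → y = 0) := by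
    intro b
    by_cases h0 : ∀ F, z F b = 0
    · exact ⟨0, fun F => (A m).zero_mem, by rw [map_zero]; funext F; exact (h0 F).symm,
        fun _ => rfl⟩
    · obtain ⟨y, hy, hy'⟩ := hreg m hm (fun F => z F b) (fun F => hz F b) (by
        have := koszulBoundary_map x (Finsupp.lapply b : (ι →₀ L) →ₗ[L] L) z
        simp only [Finsupp.lapply_apply] at this
        rw [this, hcyc]
        rfl)
      exact ⟨y, hy, hy', fun h => absurd h h0⟩
  choose y hy hy' hy0 using hb
  set T : Finset ι := Finset.univ.biUnion fun F => (z F).support with hT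
  have hsupp : ∀ F b, y b F ≠ 0 → b ∈ T := by
    intro F b hne
    by_contra hbT
    refine hne (congrFun (hy0 b fun G => ?_) F)
    by_contra hG
    exact hbT (Finset.mem_biUnion.2 ⟨G, Finset.mem_univ _, Finsupp.mem_support_iff.2 hG⟩)
  set Y : Finset V → ι →₀ L := fun F => Finsupp.onFinset T (fun b => y b F) (hsupp F) with hY
  refine ⟨Y, fun F b => hy b F, ?_⟩
  funext G
  ext b
  have h1 := congrFun (koszulBoundary_map x (Finsupp.lapply b : (ι →₀ L) →ₗ[L] L) Y) G
  have h2 := congrFun (hy' b) G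
  exact h1.symm.trans h2

/-- If the middle term of a short exact sequence is `c`-regular and the quotient is
`(c - 1)`-regular, then the kernel is `c`-regular. -/
theorem KoszulRegular.ker {A : ℕ → Submodule k L} {x : V → L} {d : ℕ} (hd : 1 ≤ d)
    (hx : ∀ v, x v ∈ A 1)
    {X Y : Type} [AddCommGroup X] [Module L X] [Module k X]
    [AddCommGroup Y] [Module L Y] [Module k Y] {M : ℕ → Submodule k X} {N : ℕ → Submodule k Y}
    (hM : ∀ m, ∀ a ∈ A 1, ∀ f ∈ M m, a • f ∈ M (m + 1))
    (hMreg : KoszulRegular x M d) (hNreg : KoszulRegular x N d)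
    (φ : X →ₗ[L] Y) (hφ : ∀ m, ∀ f ∈ M m, φ f ∈ N (m + d))
    (hsurj : ∀ m, ∀ g ∈ N (m + d), ∃ f ∈ M m, φ f = g)
    {K : ℕ → Submodule k X} (hK : ∀ m f, f ∈ K m ↔ f ∈ M m ∧ φ f = 0) :
    KoszulRegular x K d := by
  intro m hm z hz hcyc
  obtain ⟨y, hy, hyz⟩ := hMreg m hm z (fun F => ((hK _ _).1 (hz F)).1) hcyc
  obtain ⟨m, rfl⟩ : ∃ m', m = m' + 1 := ⟨m - 1, by omega⟩
  obtain ⟨u, hu, huy⟩ := hNreg (m + d) (by omega) (fun F => φ (y F))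
    (fun F => by
      have := hφ _ _ (hy F)
      rwa [show m + 1 + d = m + d + 1 by omega] at this)
    (by
      rw [koszulBoundary_map, hyz]
      funext F
      exact ((hK _ _).1 (hz F)).2)
  choose U hU hUu using fun F => hsurj m (u F) (hu F)
  refine ⟨y - koszulBoundary x U, fun F => (hK _ _).2 ⟨?_, ?_⟩, ?_⟩
  · exact Submodule.sub_mem _ (hy F) (koszulBoundary_mem hx hM hU F)
  · have h1 := congrFun (koszulBoundary_map x φ U) F
    have h2 := congrFun huy F
    simp only [hUu] at h1
    rw [Pi.sub_apply, map_sub, ← h1, h2, sub_self]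
  · rw [map_sub, koszulBoundary_comp, sub_zero, hyz]

theorem KoszulRegular.exists_eq_sum {X : Type} [AddCommGroup X] [Module L X] [Module k X]
    {x : V → L} {N : ℕ → Submodule k X} {c : ℕ} (h : KoszulRegular x N c) {m : ℕ} (hm : c ≤ m)
    {g : X} (hg : g ∈ N (m + 1)) : ∃ y : V → X, (∀ v, y v ∈ N m) ∧ g = ∑ v, x v • y v := by
  obtain ⟨y, hy, hyz⟩ := h m hm (Pi.single ∅ g) (fun F => by
      by_cases hF : F = ∅
      · subst hF; simpa using hg
      · rw [Pi.single_eq_of_ne hF]; exact Submodule.zero_mem _) (by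
      funext G
      rw [koszulBoundary_apply]
      refine Finset.sum_eq_zero fun v _ => ?_
      rw [Pi.single_eq_of_ne (Finset.insert_ne_empty v G)]; simp)
  refine ⟨fun v => koszulSign v ∅ • y {v}, fun v => zsmul_mem (hy _) _, ?_⟩
  have := congrFun hyz ∅
  rw [Pi.single_eq_same, koszulBoundary_apply] at this
  rw [← this, Finset.compl_empty]
  exact Finset.sum_congr rfl fun v _ => by rw [smul_comm, insert_empty_eq]

/-- A `d`-regular graded submodule of a free module with basis `ι`; its Veronese piece is a syzygy
module in the linear resolution over the Veronese ring. -/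
structure SyzygyStage (A : ℕ → Submodule k L) (x : V → L) (d : ℕ) where
  ι : Type
  N : ℕ → Submodule k (ι →₀ L)
  le : ∀ m, N m ≤ finsuppPiece A ι m
  smul_mem : ∀ i m, ∀ a ∈ A i, ∀ f ∈ N m, a • f ∈ N (i + m)
  reg : KoszulRegular x N d

namespace SyzygyStage

variable {A : ℕ → Submodule k L} {x : V → L} {d : ℕ}

/-- Index type of a basis of the degree `d` piece. -/
abbrev Gen (s : SyzygyStage A x d) : Type := Module.Basis.ofVectorSpaceIndex k (s.N d)

/-- The element of the free module belonging to a generator. -/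
def gen (s : SyzygyStage A x d) (b : s.Gen) : s.ι →₀ L := ((b : s.N d) : s.ι →₀ L)

/-- The map from the free module on the generators. -/
noncomputable def ev (s : SyzygyStage A x d) : (s.Gen →₀ L) →ₗ[L] (s.ι →₀ L) :=
  Finsupp.linearCombination L s.gen

theorem gen_mem (s : SyzygyStage A x d) (b : s.Gen) : s.gen b ∈ s.N d := (b : s.N d).2

theorem ev_mem (s : SyzygyStage A x d) {m : ℕ} {f : s.Gen →₀ L} (hf : f ∈ finsuppPiece A s.Gen m) :
    s.ev f ∈ s.N (m + d) := by
  rw [ev, Finsupp.linearCombination_apply]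
  exact Submodule.sum_mem _ fun b _ => s.smul_mem _ _ _ (hf b) _ (s.gen_mem b)

theorem exists_ev_eq (s : SyzygyStage A x d) (hA1 : (1 : L) ∈ A 0) (hx : ∀ v, x v ∈ A 1)
    (hmul : ∀ i j, ∀ a ∈ A i, ∀ b ∈ A j, a * b ∈ A (i + j)) (m : ℕ) :
    ∀ g ∈ s.N (m + d), ∃ f ∈ finsuppPiece A s.Gen m, s.ev f = g := by
  induction m with
  | zero =>
    intro g hg
    rw [zero_add] at hg
    set B := Module.Basis.ofVectorSpace k (s.N d)
    refine ⟨(B.repr ⟨g, hg⟩).mapRange (algebraMap k L) (map_zero _), fun b => ?_, ?_⟩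
    · rw [Finsupp.mapRange_apply, Algebra.algebraMap_eq_smul_one]
      exact Submodule.smul_mem _ _ hA1
    · have h1 := congrArg (Submodule.subtype (s.N d)) (B.linearCombination_repr ⟨g, hg⟩)
      rw [Finsupp.linearCombination_apply, Finsupp.sum, map_sum] at h1
      rw [ev, Finsupp.linearCombination_apply, Finsupp.sum_mapRange_index (by simp)]
      refine Eq.trans ?_ h1
      refine Finset.sum_congr rfl fun b _ => ?_
      simp [gen, B]
  | succ m ih =>
    intro g hg
    rw [show m + 1 + d = m + d + 1 by omega] at hg
    obtain ⟨y, hy, rfl⟩ := s.reg.exists_eq_sum (Nat.le_add_left d m) hg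
    choose f hf hfy using fun v => ih (y v) (hy v)
    refine ⟨∑ v, x v • f v, Submodule.sum_mem _ fun v _ b => ?_, ?_⟩
    · rw [Finsupp.smul_apply, smul_eq_mul, add_comm m]
      exact hmul _ _ _ (hx v) _ (hf v b)
    · simp [hfy]

/-- The module of relations between the generators. -/
noncomputable def next (s : SyzygyStage A x d) (hd : 1 ≤ d) (hA1 : (1 : L) ∈ A 0)
    (hx : ∀ v, x v ∈ A 1) (hmul : ∀ i j, ∀ a ∈ A i, ∀ b ∈ A j, a * b ∈ A (i + j))
    (hreg : KoszulRegular x A d) : SyzygyStage A x d where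
  ι := s.Gen
  N m := finsuppPiece A s.Gen m ⊓ (LinearMap.ker s.ev).restrictScalars k
  le _ := inf_le_left
  smul_mem _ _ a ha f hf := by
    refine ⟨fun b => hmul _ _ _ ha _ (hf.1 b), ?_⟩
    have : s.ev f = 0 := hf.2
    change s.ev (a • f) = 0
    rw [map_smul, this, smul_zero]
  reg := KoszulRegular.ker (M := finsuppPiece A s.Gen) hd hx
    (fun m a ha f hf b => by rw [add_comm m]; exact hmul _ _ _ ha _ (hf b))
    (hreg.finsuppPiece s.Gen) s.reg s.ev (fun m f hf => s.ev_mem hf)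
    (s.exists_ev_eq hA1 hx hmul) (fun m f => Iff.rfl)

/-- The initial stage: the ring itself. -/
def initial (hmul : ∀ i j, ∀ a ∈ A i, ∀ b ∈ A j, a * b ∈ A (i + j))
    (hreg : KoszulRegular x A d) : SyzygyStage A x d where
  ι := Unit
  N := finsuppPiece A Unit
  le _ := le_rfl
  smul_mem _ _ _ ha _ hf b := hmul _ _ _ ha _ (hf b)
  reg := hreg.finsuppPiece Unit

end SyzygyStage

end Regularity
section Veronese

variable {k L R V : Type} [Field k] [CommRing L] [Algebra k L] [CommRing R] [Algebra k R]
  [Fintype V] [LinearOrder V] {A : ℕ → Submodule k L} {x : V → L} {d : ℕ}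

/-- Base change of coefficients along `j`. -/
noncomputable def coeffMap (j : R →ₐ[k] L) {ι : Type} : (ι →₀ R) →+ (ι →₀ L) :=
  Finsupp.mapRange.addMonoidHom (j : R →+ L)

theorem coeffMap_apply (j : R →ₐ[k] L) {ι : Type} (f : ι →₀ R) (a : ι) :
    coeffMap j f a = j (f a) := rfl

theorem coeffMap_injective {j : R →ₐ[k] L} (hj : Function.Injective j) {ι : Type} :
    Function.Injective (coeffMap j : (ι →₀ R) →+ (ι →₀ L)) := by
  intro f g h
  ext a
  exact hj (DFunLike.congr_fun h a)

theorem coeffMap_smul (j : R →ₐ[k] L) {ι : Type} (r : R) (f : ι →₀ R) :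
    coeffMap j (r • f) = j r • coeffMap j f := by
  ext a
  simp [coeffMap_apply]

theorem exists_coeffMap_eq {𝒜 : ℕ → Submodule k R} {j : R →ₐ[k] L}
    (hjA : ∀ ℓ, (𝒜 ℓ).map j.toLinearMap = A (d * ℓ)) {ι : Type} {ℓ : ℕ} {f : ι →₀ L}
    (hf : f ∈ finsuppPiece A ι (d * ℓ)) :
    ∃ g : ι →₀ R, coeffMap j g = f ∧ ∀ a, g a ∈ 𝒜 ℓ := by
  classical
  have h : ∀ a, ∃ r ∈ 𝒜 ℓ, j r = f a := fun a => by
    have := hf a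
    rw [← hjA] at this
    exact this
  choose r hr hrf using h
  refine ⟨Finsupp.onFinset f.support (fun a => if f a = 0 then 0 else r a) fun a ha => ?_, ?_, ?_⟩
  · rw [Finsupp.mem_support_iff]
    intro h0
    simp [h0] at ha
  · ext a
    rw [coeffMap_apply, Finsupp.onFinset_apply]
    split_ifs with h
    · rw [map_zero, h]
    · exact hrf a
  · intro a
    rw [Finsupp.onFinset_apply]
    split_ifs
    · exact Submodule.zero_mem _
    · exact hr a

/-- Componentwise projection to degree `ℓ`. -/
noncomputable def degreePart (𝒜 : ℕ → Submodule k R) [GradedAlgebra 𝒜] {ι : Type} (ℓ : ℕ) :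
    (ι →₀ R) →+ (ι →₀ R) :=
  Finsupp.mapRange.addMonoidHom (GradedRing.proj 𝒜 ℓ)

theorem degreePart_apply (𝒜 : ℕ → Submodule k R) [GradedAlgebra 𝒜] {ι : Type} (ℓ : ℕ)
    (f : ι →₀ R) (a : ι) : degreePart 𝒜 ℓ f a = DirectSum.decompose 𝒜 (f a) ℓ := rfl

theorem mem_of_degreePart_mem (𝒜 : ℕ → Submodule k R) [GradedAlgebra 𝒜] {ι : Type}
    (W : AddSubmonoid (ι →₀ R)) (f : ι →₀ R) (h : ∀ ℓ, degreePart 𝒜 ℓ f ∈ W) : f ∈ W := by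
  classical
  set T : Finset ℕ := f.support.biUnion fun a => (DirectSum.decompose 𝒜 (f a)).support
  have : f = ∑ ℓ ∈ T, degreePart 𝒜 ℓ f := by
    ext a
    rw [Finsupp.finsetSum_apply]
    simp only [degreePart_apply]
    by_cases ha : f a = 0
    · simp [ha]
    conv_lhs => rw [← DirectSum.sum_support_decompose 𝒜 (f a)]
    refine Finset.sum_subset (fun ℓ hℓ => Finset.mem_biUnion.2
      ⟨a, Finsupp.mem_support_iff.2 ha, hℓ⟩) fun ℓ _ hℓ => ?_
    simpa using hℓ
  rw [this]
  exact W.sum_mem fun ℓ _ => h ℓ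

namespace SyzygyStage

variable (s : SyzygyStage A x d) {𝒜 : ℕ → Submodule k R} {j : R →ₐ[k] L}

theorem exists_lift_gen (hjA : ∀ ℓ, (𝒜 ℓ).map j.toLinearMap = A (d * ℓ)) (b : s.Gen) :
    ∃ g : s.ι →₀ R, coeffMap j g = s.gen b ∧ ∀ a, g a ∈ 𝒜 1 :=
  exists_coeffMap_eq hjA (by rw [mul_one]; exact s.le _ (s.gen_mem b))

variable (hjA : ∀ ℓ, (𝒜 ℓ).map j.toLinearMap = A (d * ℓ))

/-- The linear map of free modules over the Veronese ring attached to a stage. -/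
noncomputable def diff : (s.Gen →₀ R) →ₗ[R] (s.ι →₀ R) :=
  Finsupp.linearCombination R fun b => (s.exists_lift_gen hjA b).choose

theorem coeffMap_diff (f : s.Gen →₀ R) : coeffMap j (s.diff hjA f) = s.ev (coeffMap j f) := by
  induction f using Finsupp.induction_linear with
  | zero => simp only [map_zero]
  | add f g hf hg => simp only [map_add, hf, hg]
  | single b r =>
    have h1 : coeffMap j (Finsupp.single b r) = Finsupp.single b (j r) :=
      Finsupp.mapRange_single (hf := map_zero j)
    rw [h1, diff, ev, Finsupp.linearCombination_single, Finsupp.linearCombination_single,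
      coeffMap_smul, (s.exists_lift_gen hjA b).choose_spec.1]

theorem diff_single_mem (b : s.Gen) (a : s.ι) : s.diff hjA (Finsupp.single b 1) a ∈ 𝒜 1 := by
  rw [diff, Finsupp.linearCombination_single, one_smul]
  exact (s.exists_lift_gen hjA b).choose_spec.2 a

theorem diff_apply_mem {I : Ideal R} (hI : ∀ r ∈ 𝒜 1, r ∈ I) (f : s.Gen →₀ R) (a : s.ι) :
    s.diff hjA f a ∈ I := by
  rw [diff, Finsupp.linearCombination_apply, Finsupp.sum, Finsupp.finsetSum_apply]
  exact I.sum_mem fun b _ => I.mul_mem_left _ (hI _ ((s.exists_lift_gen hjA b).choose_spec.2 a))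

theorem diff_degreePart [GradedAlgebra 𝒜] (ℓ : ℕ) (f : s.Gen →₀ R) :
    s.diff hjA (degreePart 𝒜 ℓ f) = degreePart 𝒜 (ℓ + 1) (s.diff hjA f) := by
  rw [diff, Finsupp.linearCombination_apply, Finsupp.linearCombination_apply, degreePart,
    Finsupp.mapRange.addMonoidHom_apply, Finsupp.sum_mapRange_index (by simp), Finsupp.sum,
    Finsupp.sum, map_sum]
  refine Finset.sum_congr rfl fun b _ => ?_
  ext a
  rw [degreePart_apply, Finsupp.smul_apply, Finsupp.smul_apply, smul_eq_mul, smul_eq_mul,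
    DirectSum.coe_decompose_mul_add_of_right_mem 𝒜 ((s.exists_lift_gen hjA b).choose_spec.2 a)]
  rfl

theorem mem_range_diff (hj : Function.Injective j) (hA1 : (1 : L) ∈ A 0) (hx : ∀ v, x v ∈ A 1)
    (hmul : ∀ i j, ∀ a ∈ A i, ∀ b ∈ A j, a * b ∈ A (i + j)) {ℓ : ℕ} {f : s.ι →₀ R}
    (hf : coeffMap j f ∈ s.N (d * (ℓ + 1))) : f ∈ LinearMap.range (s.diff hjA) := by
  rw [mul_add, mul_one] at hf
  obtain ⟨g, hg, hgf⟩ := s.exists_ev_eq hA1 hx hmul _ _ hf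
  obtain ⟨h, rfl, -⟩ := exists_coeffMap_eq hjA hg
  refine ⟨h, coeffMap_injective hj ?_⟩
  rw [coeffMap_diff, hgf]

theorem ker_diff_eq_range [GradedAlgebra 𝒜] (hd : 1 ≤ d) (hj : Function.Injective j)
    (hA0 : ∀ a ∈ A 0, ∃ c : k, a = algebraMap k L c) (hA1 : (1 : L) ∈ A 0)
    (hx : ∀ v, x v ∈ A 1)
    (hmul : ∀ i j, ∀ a ∈ A i, ∀ b ∈ A j, a * b ∈ A (i + j)) (hreg : KoszulRegular x A d) :
    LinearMap.ker (s.diff hjA) = LinearMap.range ((s.next hd hA1 hx hmul hreg).diff hjA) := by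
  apply le_antisymm
  · intro f hf
    refine mem_of_degreePart_mem 𝒜 (LinearMap.range _).toAddSubmonoid f fun ℓ => ?_
    have hfl : s.diff hjA (degreePart 𝒜 ℓ f) = 0 := by
      rw [diff_degreePart, LinearMap.mem_ker.1 hf, map_zero]
    have hev : s.ev (coeffMap j (degreePart 𝒜 ℓ f)) = 0 := by
      rw [← coeffMap_diff s hjA, hfl, map_zero]
    have hpiece : coeffMap j (degreePart 𝒜 ℓ f) ∈ finsuppPiece A s.Gen (d * ℓ) := fun b => by
      rw [← hjA, coeffMap_apply, degreePart_apply]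
      exact ⟨_, SetLike.coe_mem _, rfl⟩
    cases ℓ with
    | succ ℓ =>
      exact mem_range_diff (s.next hd hA1 hx hmul hreg) hjA hj hA1 hx hmul (ℓ := ℓ) ⟨hpiece, hev⟩
    | zero =>
      suffices h : coeffMap j (degreePart 𝒜 0 f) = 0 by
        rw [coeffMap_injective hj (h.trans (map_zero _).symm)]
        exact Submodule.zero_mem _
      rw [mul_zero] at hpiece
      choose c hc using fun b => hA0 _ (hpiece b)
      set g := coeffMap j (degreePart 𝒜 0 f)
      have hli := (Module.Basis.ofVectorSpace k (s.N d)).linearIndependent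
      have h0 := linearIndependent_iff'.1 hli g.support c (by
        apply Subtype.ext
        rw [ev, Finsupp.linearCombination_apply] at hev
        refine Eq.trans ?_ hev
        rw [AddSubmonoidClass.coe_finsetSum]
        refine Finset.sum_congr rfl fun b _ => ?_
        rw [hc b]
        simp [gen])
      ext b
      by_cases hb : b ∈ g.support
      · rw [hc b, h0 b hb, map_zero]; rfl
      · simpa using hb
  · rintro _ ⟨f, rfl⟩
    refine LinearMap.mem_ker.2 (coeffMap_injective hj ?_)
    refine (coeffMap_diff s hjA _).trans (Eq.trans ?_ (map_zero _).symm)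
    have h2 := coeffMap_diff (s.next hd hA1 hx hmul hreg) hjA f
    refine (congrArg s.ev h2).trans ?_
    have : ∀ g : (s.next hd hA1 hx hmul hreg).Gen →₀ L,
        s.ev ((s.next hd hA1 hx hmul hreg).ev g) = 0 := by
      intro g
      induction g using Finsupp.induction_linear with
      | zero => exact (congrArg s.ev (map_zero _)).trans (map_zero _)
      | add f g hf hg =>
        refine (congrArg s.ev (map_add _ f g)).trans ((map_add s.ev _ _).trans ?_)
        exact (congrArg₂ (· + ·) hf hg).trans (add_zero 0)
      | single b c =>
        have h3 : s.ev ((s.next hd hA1 hx hmul hreg).gen b) = 0 :=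
          ((s.next hd hA1 hx hmul hreg).gen_mem b).2
        refine (congrArg s.ev (Finsupp.linearCombination_single L c b)).trans ?_
        exact (map_smul s.ev c _).trans ((congrArg (c • ·) h3).trans (smul_zero c))
    exact this _

end SyzygyStage

/-- The iterated syzygy modules. -/
noncomputable def syzygyStage (hd : 1 ≤ d) (hA1 : (1 : L) ∈ A 0) (hx : ∀ v, x v ∈ A 1)
    (hmul : ∀ i j, ∀ a ∈ A i, ∀ b ∈ A j, a * b ∈ A (i + j)) (hreg : KoszulRegular x A d) :
    ℕ → SyzygyStage A x d
  | 0 => SyzygyStage.initial hmul hreg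
  | i + 1 => (syzygyStage hd hA1 hx hmul hreg i).next hd hA1 hx hmul hreg

/-- The `d`-th Veronese ring of a `d`-regular graded algebra is Koszul. -/
theorem isKoszul_of_koszulRegular (𝒜 : ℕ → Submodule k R) [GradedAlgebra 𝒜] {j : R →ₐ[k] L}
    (hjA : ∀ ℓ, (𝒜 ℓ).map j.toLinearMap = A (d * ℓ)) (hd : 1 ≤ d) (hj : Function.Injective j)
    (hA0 : ∀ a ∈ A 0, ∃ c : k, a = algebraMap k L c) (hA1 : (1 : L) ∈ A 0)
    (hx : ∀ v, x v ∈ A 1)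
    (hmul : ∀ i j, ∀ a ∈ A i, ∀ b ∈ A j, a * b ∈ A (i + j)) (hreg : KoszulRegular x A d) :
    IsKoszul 𝒜 := by
  set S := syzygyStage hd hA1 hx hmul hreg
  set I : Ideal R := Ideal.span (⋃ n ∈ {n : ℕ | 0 < n}, ((𝒜 n : Submodule k R) : Set R)) with hI
  have hS0 : S 0 = SyzygyStage.initial hmul hreg := rfl
  let ε : (Unit →₀ R) →ₗ[R] R ⧸ I := (Submodule.mkQ I).comp (Finsupp.lapply ())
  refine ⟨fun i => (S i).ι, fun i => (S i).diff hjA, ε, ?_, ?_, fun i => ?_, fun i b a => ?_⟩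
  · intro r
    obtain ⟨r, rfl⟩ := Submodule.mkQ_surjective I r
    exact ⟨Finsupp.single () r, congrArg (Submodule.mkQ I) Finsupp.single_eq_same⟩
  · apply le_antisymm
    · have hle : I ≤ Submodule.comap (Finsupp.lsingle () : R →ₗ[R] Unit →₀ R)
          (LinearMap.range ((SyzygyStage.initial hmul hreg).diff hjA)) := by
        rw [hI, Ideal.span_le]
        intro r hr
        simp only [Set.mem_ofPred_eq, Set.mem_iUnion, SetLike.mem_coe] at hr
        obtain ⟨ℓ, hℓ, hr⟩ := hr
        obtain ⟨ℓ, rfl⟩ : ∃ m, ℓ = m + 1 := ⟨ℓ - 1, by omega⟩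
        refine SyzygyStage.mem_range_diff _ hjA hj hA1 hx hmul (ℓ := ℓ) fun b => ?_
        rw [← hjA]
        exact ⟨r, hr, congrArg j (Finsupp.single_eq_same (a := b) (b := r)).symm⟩
      intro f hf
      have hf' : f () ∈ I := (Submodule.Quotient.mk_eq_zero I).1 (LinearMap.mem_ker.1 hf)
      have := hle hf'
      rw [Submodule.mem_comap] at this
      have hfs : (Finsupp.lsingle () : R →ₗ[R] Unit →₀ R) (f ()) = f := by
        ext
        exact Finsupp.single_eq_same
      rwa [hfs] at this
    · rintro _ ⟨f, rfl⟩
      refine LinearMap.mem_ker.2 ((Submodule.Quotient.mk_eq_zero I).2 ?_)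
      refine SyzygyStage.diff_apply_mem (S 0) hjA (fun r hr => Ideal.subset_span ?_) f ()
      simp only [Set.mem_ofPred_eq, Set.mem_iUnion, SetLike.mem_coe]
      exact ⟨1, one_pos, hr⟩
  · exact (S i).ker_diff_eq_range hjA hd hj hA0 hA1 hx hmul hreg
  · exact (S i).diff_single_mem hjA b a

end Veronese
section LinearProgram

variable {I V : Type} [Fintype V]

/-- The linear combination of the integer vectors `a v` with real coefficients. -/
def comb (a : V → I → ℤ) : (V → ℝ) →ₗ[ℝ] (I → ℝ) where
  toFun c i := ∑ v, c v * a v i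
  map_add' c c' := by funext i; simp [add_mul, Finset.sum_add_distrib]
  map_smul' t c := by funext i; simp [Finset.mul_sum, mul_assoc]

theorem comb_apply (a : V → I → ℤ) (c : V → ℝ) (i : I) : comb a c i = ∑ v, c v * a v i := rfl

theorem comb_single [DecidableEq V] (a : V → I → ℤ) (v : V) :
    comb a (Pi.single v 1) = fun i => (a v i : ℝ) := by
  funext i
  simp [comb_apply, Pi.single_apply]

/-- The linear functional with coefficients `w`. -/
def cost (w : V → ℝ) : (V → ℝ) →ₗ[ℝ] ℝ where
  toFun c := ∑ v, w v * c v
  map_add' c c' := by simp [mul_add, Finset.sum_add_distrib]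
  map_smul' t c := by simp [Finset.mul_sum, mul_left_comm]

theorem cost_apply (w c : V → ℝ) : cost w c = ∑ v, w v * c v := rfl

theorem cost_single [DecidableEq V] (w : V → ℝ) (v : V) : cost w (Pi.single v 1) = w v := by
  simp [cost_apply, Pi.single_apply]

/-- `c` minimizes the cost among the nonnegative solutions of `comb a c = y`. -/
def IsOpt (a : V → I → ℤ) (w : V → ℝ) (y : I → ℝ) (c : V → ℝ) : Prop :=
  (0 ≤ c ∧ comb a c = y) ∧ ∀ c', 0 ≤ c' → comb a c' = y → cost w c ≤ cost w c'

/-- No relation which is nonnegative off `T` has negative cost. -/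
def IsLow (a : V → I → ℤ) (w : V → ℝ) (T : Set V) : Prop :=
  ∀ μ, comb a μ = 0 → (∀ v ∉ T, 0 ≤ μ v) → 0 ≤ cost w μ

variable {a : V → I → ℤ} {w : V → ℝ} {y : I → ℝ} {c : V → ℝ}

theorem IsLow.mono {S T : Set V} (h : IsLow a w T) (hST : S ⊆ T) : IsLow a w S :=
  fun μ hμ hT => h μ hμ fun v hv => hT v fun hvS => hv (hST hvS)

theorem IsOpt.isLow (h : IsOpt a w y c) : IsLow a w {v | 0 < c v} := by
  intro μ hμ hT
  have hev : ∀ᶠ ε in nhdsWithin (0 : ℝ) (Set.Ioi 0), ∀ v, 0 ≤ c v + ε * μ v := by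
    rw [Filter.eventually_all]
    intro v
    by_cases hv : 0 < c v
    · have hc : Filter.Tendsto (fun ε : ℝ => c v + ε * μ v) (nhdsWithin 0 (Set.Ioi 0))
          (nhds (c v + 0 * μ v)) :=
        (Continuous.tendsto (by fun_prop) 0).mono_left nhdsWithin_le_nhds
      rw [zero_mul, add_zero] at hc
      exact (hc.eventually_const_lt hv).mono fun ε => le_of_lt
    · filter_upwards [self_mem_nhdsWithin] with ε hε
      exact add_nonneg (h.1.1 v) (mul_nonneg (le_of_lt hε) (hT v hv))
  obtain ⟨ε, hε, hε0⟩ := (hev.and self_mem_nhdsWithin).exists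
  have h1 := h.2 (c + ε • μ) hε (by rw [map_add, map_smul, hμ, smul_zero, add_zero, h.1.2])
  rw [map_add, map_smul, smul_eq_mul] at h1
  exact nonneg_of_mul_nonneg_right (by linarith) hε0

theorem IsLow.isOpt (hc : 0 ≤ c) (h : IsLow a w {v | 0 < c v}) : IsOpt a w (comb a c) c := by
  refine ⟨⟨hc, rfl⟩, fun c' hc' hcc' => ?_⟩
  have := h (c' - c) (by rw [map_sub, hcc', sub_self]) fun v hv => by
    have h0 : c v = 0 := le_antisymm (not_lt.1 hv) (hc v)
    rw [Pi.sub_apply, h0, sub_zero]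
    exact hc' v
  rw [map_sub] at this
  linarith

theorem IsOpt.of_support (h : IsOpt a w y c) {c' : V → ℝ} (hc' : 0 ≤ c')
    (hsupp : ∀ v, 0 < c' v → 0 < c v) : IsOpt a w (comb a c') c' :=
  (h.isLow.mono fun v => hsupp v).isOpt hc'

theorem IsLow.eq_zero (hw : LinearIndependent ℚ w) {T : Set V} (h : IsLow a w T) {μ : V → ℝ}
    (hμ : comb a μ = 0) (hT : ∀ v ∉ T, μ v = 0) : μ = 0 := by
  funext v₀
  refine (Module.forall_dual_apply_eq_zero_iff ℚ (μ v₀)).1 fun φ => ?_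
  set ρ : V → ℝ := fun v => (φ (μ v) : ℝ) with hρ
  have hρ0 : comb a ρ = 0 := by
    funext i
    have h1 := congrArg φ (congrFun hμ i)
    rw [comb_apply, map_sum, Pi.zero_apply, map_zero] at h1
    have h2 : ∀ v, φ (μ v * a v i) = φ (μ v) * a v i := fun v => by
      rw [mul_comm, ← zsmul_eq_mul, map_zsmul, zsmul_eq_mul, mul_comm]
    simp only [h2] at h1
    rw [comb_apply, Pi.zero_apply]
    simp only [hρ]
    exact_mod_cast h1
  have hρT : ∀ v ∉ T, ρ v = 0 := fun v hv => by rw [hρ]; simp [hT v hv]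
  have h1 := h ρ hρ0 fun v hv => (hρT v hv).ge
  have h2 := h (-ρ) (by rw [map_neg, hρ0, neg_zero]) fun v hv => by
    rw [Pi.neg_apply, hρT v hv, neg_zero]
  rw [map_neg] at h2
  have h3 : ∑ v, φ (μ v) • w v = 0 := by
    have : cost w ρ = 0 := by linarith
    rw [← this, cost_apply]
    exact Finset.sum_congr rfl fun v _ => by rw [Rat.smul_def, mul_comm]
  exact Fintype.linearIndependent_iff.1 hw _ h3 v₀

theorem IsOpt.unique (hw : LinearIndependent ℚ w) {c' : V → ℝ} (h : IsOpt a w y c)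
    (h' : IsOpt a w y c') : c = c' := by
  have heq : cost w c = cost w c' := le_antisymm (h.2 _ h'.1.1 h'.1.2) (h'.2 _ h.1.1 h.1.2)
  set b : V → ℝ := (1 / 2 : ℝ) • (c + c') with hb
  have hb0 : 0 ≤ b := smul_nonneg (by norm_num) (add_nonneg h.1.1 h'.1.1)
  have hopt : IsOpt a w y b := by
    refine ⟨⟨hb0, ?_⟩, fun d hd hdy => ?_⟩
    · rw [hb, map_smul, map_add, h.1.2, h'.1.2]
      funext i
      simp only [Pi.smul_apply, Pi.add_apply, smul_eq_mul]
      ring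
    · have := h.2 d hd hdy
      rw [hb, map_smul, map_add, smul_eq_mul]
      linarith
  have := hopt.isLow.eq_zero hw (μ := c - c') (by rw [map_sub, h.1.2, h'.1.2, sub_self])
    fun v hv => by
      have h1 : b v ≤ 0 := not_lt.1 hv
      have h2 := h.1.1 v
      have h3 := h'.1.1 v
      simp only [hb, Pi.smul_apply, Pi.add_apply, smul_eq_mul, Pi.zero_apply] at h1 h2 h3
      rw [Pi.sub_apply]
      linarith
  exact sub_eq_zero.1 this

theorem le_of_comb_eq {i₀ : I} (ha : ∀ v, a v i₀ = 1) (hc : 0 ≤ c) (hcy : comb a c = y) (v : V) :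
    c v ≤ y i₀ := by
  rw [← hcy, comb_apply]
  simp only [ha, Int.cast_one, mul_one]
  exact Finset.single_le_sum (fun u _ => hc u) (Finset.mem_univ v)

theorem continuous_comb [Finite I] : Continuous (comb a) :=
  LinearMap.continuous_of_finiteDimensional _

theorem exists_isOpt [Finite I] {i₀ : I} (ha : ∀ v, a v i₀ = 1) (hc : 0 ≤ c)
    (hcy : comb a c = y) : ∃ c', IsOpt a w y c' := by
  set K : Set (V → ℝ) := Set.Icc 0 (fun _ => y i₀) ∩ {c | comb a c = y} with hK
  have hcomp : IsCompact K :=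
    isCompact_Icc.inter_right (isClosed_eq continuous_comb continuous_const)
  have hmem : ∀ c', 0 ≤ c' → comb a c' = y → c' ∈ K := fun c' h0 h =>
    ⟨⟨h0, fun v => le_of_comb_eq ha h0 h v⟩, h⟩
  obtain ⟨c', hc', hmin⟩ := hcomp.exists_isMinOn ⟨c, hmem c hc hcy⟩
    (LinearMap.continuous_of_finiteDimensional (cost w)).continuousOn
  exact ⟨c', ⟨hc'.1.1, hc'.2⟩, fun d hd hdy => hmin (hmem d hd hdy)⟩

/-- If adding a generator to an optimal solution remains optimal then, for generic
translation `π`, the generator was already used. -/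
theorem IsOpt.pos_of_add [DecidableEq V] (hw : LinearIndependent ℚ w) {π : V → ℝ} {x : I → ℤ}
    {v : V} {ψ : ℝ →ₗ[ℚ] ℚ} (hψ1 : ψ 1 = 0) (hψ : ∀ u, ψ (π u) = if u = v then 1 else 0)
    (h : 0 ≤ c) (hc : comb a c = (fun i => (x i : ℝ)) + comb a π)
    (h' : IsOpt a w y (c + Pi.single v 1)) : 0 < c v := by
  by_contra hv
  have hv0 : c v = 0 := le_antisymm (not_lt.1 hv) (h v)
  set μ : V → ℝ := fun u => ((ψ (c u) - if u = v then 1 else 0 : ℚ) : ℝ) with hμ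
  have hψz : ∀ (t : ℝ) (n : ℤ), ψ (t * n) = ψ t * n := fun t n => by
    rw [mul_comm, ← zsmul_eq_mul, map_zsmul, zsmul_eq_mul, mul_comm]
  have hμ0 : comb a μ = 0 := by
    funext i
    have h1 := congrArg ψ (congrFun hc i)
    rw [Pi.add_apply, comb_apply, comb_apply, map_sum, map_add, map_sum,
      ← one_mul ((x i : ℤ) : ℝ)] at h1
    simp only [hψz, hψ1, zero_mul, zero_add, hψ] at h1
    rw [comb_apply, Pi.zero_apply]
    have h2 : ∑ u, (ψ (c u) - if u = v then 1 else 0) * (a u i : ℚ) = 0 := by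
      simp only [sub_mul, Finset.sum_sub_distrib, h1, sub_self]
    simp only [hμ]
    exact_mod_cast h2
  have := congrFun (h'.isLow.eq_zero hw hμ0 fun u hu => by
    have hu' : ¬ 0 < c u + (Pi.single v 1 : V → ℝ) u := hu
    have hcu := h u
    by_cases huv : u = v
    · subst huv
      rw [Pi.single_eq_same, hv0] at hu'
      norm_num at hu'
    · rw [Pi.single_eq_of_ne huv, add_zero] at hu'
      have : c u = 0 := le_antisymm (not_lt.1 hu') hcu
      simp [hμ, huv, this]) v
  simp [hμ, hv0] at this

end LinearProgram

section Generic

theorem exists_positive_generic (V : Type) [Finite V] :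
    ∃ π : V → ℝ, (∀ v, 0 < π v) ∧ LinearIndependent ℚ π ∧
      ∀ v, ∃ ψ : ℝ →ₗ[ℚ] ℚ, ψ 1 = 0 ∧ ψ (π v) = 1 ∧ ∀ u ≠ v, ψ (π u) = 0 := by
  set θ : ℝ := liouvilleNumber 2
  have hθ : Transcendental ℚ θ := fun h =>
    transcendental_liouvilleNumber le_rfl ((IsFractionRing.isAlgebraic_iff ℤ ℚ ℝ).2 h)
  have hli : LinearIndependent ℚ (fun i : ℕ => θ ^ i) := by
    have h := (Polynomial.basisMonomials ℚ).linearIndependent.map'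
      (Polynomial.aeval θ).toLinearMap (LinearMap.ker_eq_bot.2 (transcendental_iff_injective.1 hθ))
    have hfun : ⇑(Polynomial.aeval θ).toLinearMap ∘ ⇑(Polynomial.basisMonomials ℚ) =
        fun i : ℕ => θ ^ i := by
      funext i
      simp
    rw [hfun] at h
    exact h
  obtain ⟨n, ⟨e⟩⟩ := Finite.exists_equiv_fin V
  set κ : V → ℕ := fun v => 2 * ((e v : ℕ) + 1) with hκ
  have hκi : Function.Injective κ := fun u v h => e.injective (Fin.ext (by simpa [hκ] using h))
  refine ⟨fun v => θ ^ κ v, fun v => ?_, hli.comp κ hκi, fun v => ?_⟩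
  · refine Even.pow_pos (by simp [hκ]) fun h => hθ (h ▸ isAlgebraic_zero)
  · obtain ⟨ψ, hψ⟩ := LinearMap.exists_extend ((Finsupp.lapply (κ v)).comp hli.repr)
    have hψi : ∀ i : ℕ, ψ (θ ^ i) = if i = κ v then 1 else 0 := fun i => by
      have h1 := LinearMap.congr_fun hψ ⟨θ ^ i, Submodule.subset_span ⟨i, rfl⟩⟩
      rw [LinearMap.comp_apply, LinearMap.comp_apply, hli.repr_eq_single i _ rfl, Finsupp.lapply_apply, Finsupp.single_apply] at h1
      exact h1
    refine ⟨ψ, ?_, ?_, fun u hu => ?_⟩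
    · rw [← pow_zero θ, hψi, if_neg (by simp [hκ])]
    · rw [hψi, if_pos rfl]
    · rw [hψi, if_neg fun h => hu (hκi h)]

end Generic
section Cone

variable {I V : Type} [Fintype V]

/-- The lattice point `x` lies in the cone generated by the vectors `a v`. -/
def InCone (a : V → I → ℤ) (x : I → ℤ) : Prop :=
  ∃ c : V → ℝ, 0 ≤ c ∧ comb a c = fun i => (x i : ℝ)

/-- The lattice point `x` is a combination of all the `a v` with positive coefficients. -/
def StrictCone (a : V → I → ℤ) (x : I → ℤ) : Prop :=
  ∃ c : V → ℝ, (∀ v, 0 < c v) ∧ comb a c = fun i => (x i : ℝ)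

variable {a : V → I → ℤ} {i₀ : I}

theorem eventually_inCone [Finite I] (ha : ∀ v, a v i₀ = 1) (p : V → ℝ) (x : I → ℤ) :
    ∀ᶠ ε in nhdsWithin (0 : ℝ) (Set.Ioi 0), ∀ c : V → ℝ, 0 ≤ c →
      comb a c = (fun i => (x i : ℝ)) + comb a (ε • p) → InCone a x := by
  by_cases hx : InCone a x
  · exact Filter.Eventually.of_forall fun _ _ _ _ => hx
  set y : ℝ → I → ℝ := fun ε => (fun i => (x i : ℝ)) + comb a (ε • p) with hy
  have hyc : Continuous y := continuous_const.add (continuous_comb.comp (by fun_prop))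
  have hy0 : y 0 = fun i => (x i : ℝ) := by simp [hy]
  set K : Set (I → ℝ) := comb a '' Set.Icc 0 (fun _ => (x i₀ : ℝ) + 1)
  have hK : IsClosed K := (isCompact_Icc.image continuous_comb).isClosed
  have h1 : ∀ᶠ ε in nhds (0 : ℝ), y ε ∉ K := by
    refine hyc.continuousAt.eventually_mem (hK.isOpen_compl.mem_nhds ?_)
    rintro ⟨c, hc, hcx⟩
    exact hx ⟨c, hc.1, hcx.trans hy0⟩
  have h2 : ∀ᶠ ε in nhds (0 : ℝ), y ε i₀ < (x i₀ : ℝ) + 1 := by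
    have : Filter.Tendsto (fun ε => y ε i₀) (nhds 0) (nhds (y 0 i₀)) :=
      ((continuous_apply i₀).comp hyc).tendsto 0
    refine this.eventually_lt_const ?_
    rw [hy0]
    exact lt_add_one _
  filter_upwards [nhdsWithin_le_nhds h1, nhdsWithin_le_nhds h2] with ε h1 h2 c hc hcy
  exact absurd ⟨c, ⟨hc, fun v => (le_of_comb_eq ha hc hcy v).trans h2.le⟩, hcy⟩ h1

theorem IsLow.card_le [Fintype I] {w : V → ℝ} (hw : LinearIndependent ℚ w)
    {T : Finset V} (hT : IsLow a w T) : T.card ≤ Fintype.card I := by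
  classical
  have hli : LinearIndependent ℝ (fun (v : T) (i : I) => (a v i : ℝ)) := by
    rw [Fintype.linearIndependent_iff]
    intro g hg v
    set μ : V → ℝ := fun u => if h : u ∈ T then g ⟨u, h⟩ else 0 with hμ
    have h0 : μ = 0 := hT.eq_zero hw (by
      rw [← hg]
      funext i
      rw [comb_apply, Finset.sum_apply, ← Finset.sum_subset (Finset.subset_univ T) (fun u _ hu => by
        simp [hμ, hu]), ← Finset.sum_coe_sort]
      exact Finset.sum_congr rfl fun u _ => by simp [hμ]) fun u hu => by
        have : u ∉ T := hu
        simp [hμ, this]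
    have := congrFun h0 v
    simpa [hμ] using this
  have := hli.fintype_card_le_finrank
  rwa [Module.finrank_fintype_fun_eq_card, Fintype.card_coe] at this

theorem exists_koszulBoundary_eq_of_cone [LinearOrder V] [Fintype I] {k : Type} [CommRing k]
    (ha : ∀ v, a v i₀ = 1)
    {d e : ℕ} (hcard : Fintype.card I ≤ e ∨ Fintype.card V ≤ e)
    (hstrict : ∀ x, StrictCone a x → (e : ℤ) - d ≤ x i₀) (lam : I → ℤ) (i : ℕ)
    (hi : (d : ℤ) < lam i₀ - i) (z : Finset V → k)
    (hz : ∀ F, z F ≠ 0 → InCone a (lam - ∑ v ∈ F, a v) ∧ F.card = i)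
    (hcyc : koszulBoundary (fun _ => (1 : k)) z = 0) :
    ∃ y : Finset V → k, (∀ F, y F ≠ 0 → InCone a (lam - ∑ v ∈ F, a v) ∧ F.card = i + 1) ∧
      koszulBoundary (fun _ => (1 : k)) y = z := by
  classical
  obtain ⟨w, hw0, hw, hψ⟩ := exists_positive_generic V
  obtain ⟨q, hq0, hq⟩ : ∃ q : ℚ, 0 < q ∧ ∀ F : Finset V, ∀ c : V → ℝ, 0 ≤ c →
      comb a c = (fun i => ((lam - ∑ v ∈ F, a v) i : ℝ)) + comb a ((q : ℝ) • w) →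
        InCone a (lam - ∑ v ∈ F, a v) := by
    have h := Filter.eventually_all.2 fun F : Finset V =>
      eventually_inCone ha w (lam - ∑ v ∈ F, a v)
    obtain ⟨δ, hδ, hδ'⟩ := mem_nhdsGT_iff_exists_Ioo_subset.1 h
    obtain ⟨q, hq0, hqδ⟩ := exists_rat_btwn (show (0 : ℝ) < δ from hδ)
    exact ⟨q, by exact_mod_cast hq0, hδ' ⟨hq0, hqδ⟩⟩
  set π : V → ℝ := (q : ℝ) • w with hπ
  have hπ0 : ∀ v, 0 < π v := fun v => mul_pos (by exact_mod_cast hq0) (hw0 v)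
  have hψ' : ∀ v, ∃ ψ : ℝ →ₗ[ℚ] ℚ, ψ 1 = 0 ∧ ∀ u, ψ (π u) = if u = v then 1 else 0 := by
    intro v
    obtain ⟨ψ, h1, h2, h3⟩ := hψ v
    refine ⟨q⁻¹ • ψ, by simp [h1], fun u => ?_⟩
    have : π u = q • w u := by rw [hπ, Pi.smul_apply, Rat.smul_def, smul_eq_mul]
    rw [this, LinearMap.smul_apply, map_smul, smul_smul, inv_mul_cancel₀ hq0.ne', one_smul]
    split_ifs with huv
    · rw [huv, h2]
    · exact h3 u huv
  set Y : Finset V → I → ℝ :=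
    fun F => (fun i => ((lam - ∑ v ∈ F, a v) i : ℝ)) + comb a π with hY
  have hYins : ∀ F v, v ∉ F → Y F = Y (insert v F) + comb a (Pi.single v 1) := by
    intro F v hv
    funext i
    simp only [hY, comb_single, Pi.add_apply, Pi.sub_apply, Finset.sum_insert hv]
    push_cast
    ring
  set cell : Finset V → Prop := fun F => InCone a (lam - ∑ v ∈ F, a v) with hcelldef
  have hcell_of : ∀ F c, 0 ≤ c → comb a c = Y F → cell F := hq
  have hopt : ∀ F, ∃ c, cell F → IsOpt a w (Y F) c := by
    intro F
    by_cases hF : cell F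
    · obtain ⟨c, hc, hcx⟩ := hF
      have : comb a (c + π) = Y F := by rw [map_add, hcx]
      obtain ⟨c', hc'⟩ := exists_isOpt (w := w) ha (add_nonneg hc fun v => (hπ0 v).le) this
      exact ⟨c', fun _ => hc'⟩
    · exact ⟨0, fun h => absurd h hF⟩
  choose C hC using hopt
  set wt : Finset V → ℝ := fun F => cost w (C F) + ∑ v ∈ F, w v with hwt
  set D : Finset V → Finset V :=
    fun F => Finset.univ.filter fun b => 0 < C F b ∧ (b ∈ F ∨ 1 < C F b) with hD
  have hsingle : ∀ v : V, (0 : V → ℝ) ≤ Pi.single v 1 := fun v => Pi.single_nonneg.2 zero_le_one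
  have hcell : ∀ G v, v ∉ G → cell (insert v G) → cell G := by
    intro G v hv h
    refine hcell_of G (C (insert v G) + Pi.single v 1) (add_nonneg (hC _ h).1.1 (hsingle v)) ?_
    rw [map_add, (hC _ h).1.2, hYins G v hv]
  have hle : ∀ G v, v ∉ G → cell (insert v G) →
      wt G ≤ wt (insert v G) ∧ (wt G = wt (insert v G) →
        IsOpt a w (Y G) (C (insert v G) + Pi.single v 1)) := by
    intro G v hv h
    have hG := hC G (hcell G v hv h)
    have h0 : 0 ≤ C (insert v G) + Pi.single v 1 := add_nonneg (hC _ h).1.1 (hsingle v)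
    have h1 : comb a (C (insert v G) + Pi.single v 1) = Y G := by
      rw [map_add, (hC _ h).1.2, hYins G v hv]
    have h2 := hG.2 _ h0 h1
    simp only [hwt, Finset.sum_insert hv]
    rw [map_add, cost_single] at h2
    refine ⟨by linarith, fun heq => ⟨⟨h0, h1⟩, fun c' hc' hcy => ?_⟩⟩
    have := hG.2 c' hc' hcy
    rw [map_add, cost_single]
    linarith
  refine exists_koszulBoundary_eq_of_matching cell wt D hcell (fun G v hv h => (hle G v hv h).1)
    (fun G v hv h heq => ?_) (fun F v hF hvD hv => ?_) (fun F v hF hvD hv => ?_) i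
    (fun F hF hFi => ?_) z hz hcyc
  · have h1 := (hle G v hv h).2 heq
    have h2 : C G = C (insert v G) + Pi.single v 1 := (hC G (hcell G v hv h)).unique hw h1
    obtain ⟨ψ, hψ1, hψπ⟩ := hψ' v
    have h3 : 0 < C (insert v G) v :=
      IsOpt.pos_of_add hw hψ1 hψπ (hC _ h).1.1 (hC _ h).1.2 h1
    ext b
    simp only [hD, Finset.mem_filter, Finset.mem_univ, true_and, h2, Finset.mem_insert,
      Pi.add_apply]
    by_cases hb : b = v
    · subst hb
      simp only [Pi.single_eq_same, true_or, and_true, h3, iff_true]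
      exact ⟨by linarith, Or.inr (by linarith)⟩
    · simp [hb]
  · simp only [hD, Finset.mem_filter, Finset.mem_univ, true_and, hv, false_or] at hvD
    have h0 : 0 ≤ C F - Pi.single v 1 := fun b => by
      by_cases hb : b = v
      · subst hb
        rw [Pi.sub_apply, Pi.single_eq_same, Pi.zero_apply]
        linarith
      · rw [Pi.sub_apply, Pi.single_eq_of_ne hb, sub_zero]
        exact (hC F hF).1.1 b
    have h1 : comb a (C F - Pi.single v 1) = Y (insert v F) := by
      rw [map_sub, (hC F hF).1.2, hYins F v hv, add_sub_cancel_right]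
    have hins := hcell_of _ _ h0 h1
    refine ⟨hins, ?_⟩
    have h2 := (hC F hF).of_support h0 fun b hb => by
      by_cases hbv : b = v
      · subst hbv; exact hvD.1
      · rwa [Pi.sub_apply, Pi.single_eq_of_ne hbv, sub_zero] at hb
    rw [h1] at h2
    have h3 := (hC _ hins).unique hw h2
    simp only [hwt, Finset.sum_insert hv, h3]
    rw [map_sub, cost_single]
    ring
  · simp only [hD, Finset.mem_filter, Finset.mem_univ, true_and, hv, true_or, and_true] at hvD
    have hne := Finset.notMem_erase v F
    have hF' : cell (insert v (F.erase v)) := by rwa [Finset.insert_erase hv]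
    have hcE := hcell _ v hne hF'
    have h1 : comb a (C F + Pi.single v 1) = Y (F.erase v) := by
      rw [map_add, (hC F hF).1.2, hYins _ v hne, Finset.insert_erase hv]
    have h2 := (hC F hF).of_support (add_nonneg (hC F hF).1.1 (hsingle v)) fun b hb => by
      by_cases hbv : b = v
      · subst hbv; exact hvD
      · rwa [Pi.add_apply, Pi.single_eq_of_ne hbv, add_zero] at hb
    rw [h1] at h2
    have h3 := (hC _ hcE).unique hw h2
    simp only [hwt, h3]
    rw [map_add, cost_single, ← Finset.sum_erase_add _ _ hv]
    ring
  · by_contra hne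
    rw [Finset.not_nonempty_iff_eq_empty] at hne
    set T : Finset V := Finset.univ.filter fun b => 0 < C F b with hT
    have hle1 : ∀ b, C F b ≤ 1 := fun b => by
      by_contra hb
      have : b ∈ D F := by
        simp only [hD, Finset.mem_filter, Finset.mem_univ, true_and]
        exact ⟨by linarith, Or.inr (by linarith)⟩
      rw [hne] at this
      exact absurd this (Finset.notMem_empty b)
    have hTcard : T.card ≤ e := by
      rcases hcard with h | h
      · refine le_trans (IsLow.card_le (a := a) hw (T := T) ?_) h
        exact (hC F hF).isLow.mono fun v hv => by simpa [hT] using hv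
      · exact (Finset.card_le_univ T).trans h
    have hsum : ((∑ v ∈ T, a v) : I → ℤ) i₀ = T.card := by
      rw [Finset.sum_apply]; simp [ha]
    have hsumF : ((∑ v ∈ F, a v) : I → ℤ) i₀ = i := by
      rw [Finset.sum_apply]; simp [ha, hFi]
    have hs := hstrict (∑ v ∈ T, a v - (lam - ∑ v ∈ F, a v))
      ⟨(fun v => if v ∈ T then 1 else 0) - C F + π, fun v => ?_, ?_⟩
    · rw [Pi.sub_apply, Pi.sub_apply, hsum, hsumF] at hs
      have : (T.card : ℤ) ≤ e := by exact_mod_cast hTcard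
      linarith
    · have h1 := hπ0 v
      have h2 := hle1 v
      simp only [Pi.add_apply, Pi.sub_apply]
      split_ifs with hv
      · linarith
      · have : ¬ 0 < C F v := by simpa [hT] using hv
        linarith
    · have h1 : comb a (fun v => if v ∈ T then 1 else 0) =
          fun i => (((∑ v ∈ T, a v) : I → ℤ) i : ℝ) := by
        funext i
        rw [comb_apply, Finset.sum_apply]
        simp
      rw [map_add, map_sub, h1, (hC F hF).1.2]
      funext i
      simp only [hY, Pi.add_apply, Pi.sub_apply]
      push_cast
      ring

theorem InCone.exists_sub [Fintype I] (ha : ∀ v, a v i₀ = 1)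
    {d e : ℕ} (hcard : Fintype.card I ≤ e ∨ Fintype.card V ≤ e)
    (hstrict : ∀ x, StrictCone a x → (e : ℤ) - d ≤ x i₀) {x : I → ℤ} (hx : InCone a x)
    (hd : (d : ℤ) < x i₀) : ∃ v, InCone a (x - a v) := by
  classical
  let _ : LinearOrder V := LinearOrder.lift' _ (Fintype.equivFin V).injective
  obtain ⟨y, hy, hyz⟩ := exists_koszulBoundary_eq_of_cone (k := ℚ) ha hcard hstrict x 0
    (by simpa using hd) (Pi.single ∅ 1) (fun F hF => by
      by_cases h : F = ∅
      · subst h; simpa using hx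
      · exact absurd (Pi.single_eq_of_ne h _) hF) (by
      funext G
      rw [koszulBoundary_apply]
      refine Finset.sum_eq_zero fun v _ => ?_
      rw [Pi.single_eq_of_ne (Finset.insert_ne_empty v G)]; simp)
  have h1 := congrFun hyz ∅
  rw [Pi.single_eq_same, koszulBoundary_apply] at h1
  obtain ⟨v, -, hv⟩ := Finset.exists_ne_zero_of_sum_ne_zero (h1.trans_ne one_ne_zero)
  have hyv : y {v} ≠ 0 := fun h => hv (by rw [insert_empty_eq, h]; simp)
  exact ⟨v, by simpa using (hy _ hyv).1⟩

theorem InCone.add {x y : I → ℤ} (hx : InCone a x) (hy : InCone a y) : InCone a (x + y) := by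
  obtain ⟨c, hc, hcx⟩ := hx
  obtain ⟨c', hc', hcy⟩ := hy
  refine ⟨c + c', add_nonneg hc hc', ?_⟩
  rw [map_add, hcx, hcy]
  funext i
  simp

theorem inCone_zero : InCone a (0 : I → ℤ) :=
  ⟨0, le_rfl, by rw [map_zero]; funext i; simp⟩

theorem inCone_generator (v : V) : InCone a (a v) := by
  classical
  exact ⟨Pi.single v 1, Pi.single_nonneg.2 zero_le_one, comb_single a v⟩

theorem InCone.eq_zero (ha : ∀ v, a v i₀ = 1) {x : I → ℤ} (hx : InCone a x) (h0 : x i₀ = 0) :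
    x = 0 := by
  obtain ⟨c, hc, hcx⟩ := hx
  have : c = 0 := funext fun v => le_antisymm
    ((le_of_comb_eq ha hc hcx v).trans (by simp [h0])) (hc v)
  rw [this, map_zero] at hcx
  funext i
  have := congrFun hcx i
  simp only [Pi.zero_apply] at this ⊢
  exact_mod_cast this.symm

end Cone
section ConeAlgebra

variable {I V : Type} [Fintype V] {a : V → I → ℤ} {i₀ : I}

/-- The span of the monomials of degree `m` in the semigroup ring of the cone. -/
noncomputable def conePiece (k : Type) [Field k] (a : V → I → ℤ) (i₀ : I) (m : ℕ) :
    Submodule k (AddMonoidAlgebra k (I → ℤ)) :=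
  AddMonoidAlgebra.supported k k {x | InCone a x ∧ x i₀ = m}

theorem mem_conePiece {k : Type} [Field k] {m : ℕ} {f : AddMonoidAlgebra k (I → ℤ)} :
    f ∈ conePiece k a i₀ m ↔ ∀ x, f.coeff x ≠ 0 → InCone a x ∧ x i₀ = m := by
  rw [conePiece, AddMonoidAlgebra.mem_supported']
  exact forall_congr' fun x => not_imp_comm

theorem single_mem_conePiece {k : Type} [Field k] {m : ℕ} {x : I → ℤ} (hx : InCone a x)
    (hm : x i₀ = m) (t : k) : AddMonoidAlgebra.single x t ∈ conePiece k a i₀ m := by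
  classical
  rw [mem_conePiece]
  intro y hy
  rw [AddMonoidAlgebra.coeff_single, Finsupp.single_apply] at hy
  obtain rfl : x = y := by
    by_contra h
    exact hy (if_neg h)
  exact ⟨hx, hm⟩

theorem mul_mem_conePiece {k : Type} [Field k] (i j : ℕ) (f : AddMonoidAlgebra k (I → ℤ))
    (hf : f ∈ conePiece k a i₀ i) (g : AddMonoidAlgebra k (I → ℤ))
    (hg : g ∈ conePiece k a i₀ j) : f * g ∈ conePiece k a i₀ (i + j) := by
  classical
  rw [mem_conePiece] at *
  intro x hx
  obtain ⟨y, hy, z, hz, rfl⟩ := Finset.mem_add.1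
    (AddMonoidAlgebra.support_coeff_mul_subset f g (Finsupp.mem_support_iff.2 hx))
  have h1 := hf y (Finsupp.mem_support_iff.1 hy)
  have h2 := hg z (Finsupp.mem_support_iff.1 hz)
  refine ⟨h1.1.add h2.1, ?_⟩
  rw [Pi.add_apply, h1.2, h2.2]
  push_cast
  rfl

theorem exists_algebraMap_of_mem_conePiece_zero {k : Type} [Field k] (ha : ∀ v, a v i₀ = 1)
    (f : AddMonoidAlgebra k (I → ℤ)) (hf : f ∈ conePiece k a i₀ 0) :
    ∃ t : k, f = algebraMap k (AddMonoidAlgebra k (I → ℤ)) t := by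
  classical
  refine ⟨f.coeff 0, ?_⟩
  ext x
  rw [AddMonoidAlgebra.coe_algebraMap, Function.comp_apply, AddMonoidAlgebra.coeff_single, Finsupp.single_apply]
  split_ifs with h
  · rw [← h]; rfl
  · by_contra hx
    obtain ⟨h1, h2⟩ := mem_conePiece.1 hf x hx
    exact h (h1.eq_zero ha (by simpa using h2)).symm

theorem one_mem_conePiece {k : Type} [Field k] :
    (1 : AddMonoidAlgebra k (I → ℤ)) ∈ conePiece k a i₀ 0 := by
  rw [AddMonoidAlgebra.one_def]
  exact single_mem_conePiece inCone_zero rfl 1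

theorem coeff_koszulBoundary_single [LinearOrder V] {k : Type} [Field k]
    (z : Finset V → AddMonoidAlgebra k (I → ℤ)) (lam : I → ℤ) (G : Finset V) :
    (koszulBoundary (fun v => AddMonoidAlgebra.single (a v) (1 : k)) z G).coeff
        (lam - ∑ v ∈ G, a v) =
      koszulBoundary (fun _ => (1 : k)) (fun F => (z F).coeff (lam - ∑ v ∈ F, a v)) G := by
  rw [koszulBoundary_apply, koszulBoundary_apply, AddMonoidAlgebra.coeff_sum,
    Finsupp.finsetSum_apply]
  refine Finset.sum_congr rfl fun v hv => ?_
  rw [AddMonoidAlgebra.coeff_smul_apply, smul_eq_mul, smul_eq_mul, one_mul]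
  have : lam - ∑ v ∈ G, a v = a v + (lam - ∑ v ∈ insert v G, a v) := by
    rw [Finset.sum_insert (Finset.mem_compl.1 hv)]
    abel
  rw [this, AddMonoidAlgebra.coeff_single_mul_add, one_mul]

theorem koszulRegular_conePiece [LinearOrder V] [Fintype I] {k : Type} [Field k]
    (ha : ∀ v, a v i₀ = 1) {d e : ℕ} (hcard : Fintype.card I ≤ e ∨ Fintype.card V ≤ e)
    (hstrict : ∀ x, StrictCone a x → (e : ℤ) - d ≤ x i₀) :
    KoszulRegular (fun v => AddMonoidAlgebra.single (a v) (1 : k)) (conePiece k a i₀) d := by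
  classical
  intro m hm z hz hcyc
  have hsum : ∀ F : Finset V, ((∑ v ∈ F, a v) : I → ℤ) i₀ = F.card := fun F => by
    rw [Finset.sum_apply]; simp [ha]
  have hy : ∀ lam : I → ℤ, ∃ y : Finset V → k,
      (∀ F, y F ≠ 0 → InCone a (lam - ∑ v ∈ F, a v) ∧ (lam - ∑ v ∈ F, a v) i₀ = m) ∧
      (koszulBoundary (fun _ => (1 : k)) y = fun F => (z F).coeff (lam - ∑ v ∈ F, a v)) ∧
      ((∀ F, (z F).coeff (lam - ∑ v ∈ F, a v) = 0) → y = 0) := by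
    intro lam
    by_cases h0 : ∀ F, (z F).coeff (lam - ∑ v ∈ F, a v) = 0
    · refine ⟨0, fun F hF => absurd rfl hF, ?_, fun _ => rfl⟩
      rw [map_zero]
      funext F
      exact (h0 F).symm
    · have hz' := fun F => mem_conePiece.1 (hz F) (lam - ∑ v ∈ F, a v)
      obtain ⟨F₀, hF₀⟩ := not_forall.1 h0
      have hlam := (hz' F₀ hF₀).2
      rw [Pi.sub_apply, hsum] at hlam
      push_cast at hlam
      obtain ⟨y, hy, hyz⟩ := exists_koszulBoundary_eq_of_cone (k := k) ha hcard hstrict lam F₀.card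
        (by rw [hlam]; exact_mod_cast Nat.lt_succ_of_le hm)
        (fun F => (z F).coeff (lam - ∑ v ∈ F, a v)) (fun F hF => by
          have h1 := hz' F hF
          refine ⟨h1.1, ?_⟩
          have h2 := h1.2
          rw [Pi.sub_apply, hsum] at h2
          push_cast at h2
          have : (F.card : ℤ) = F₀.card := by linarith
          exact_mod_cast this) (by
          funext G
          rw [← coeff_koszulBoundary_single, hcyc]
          rfl)
      refine ⟨y, fun F hF => ⟨(hy F hF).1, ?_⟩, hyz, fun h => absurd h h0⟩
      rw [Pi.sub_apply, hsum, (hy F hF).2]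
      push_cast
      linarith
  choose y hy hyz hy0 using hy
  have hfin : ∀ F : Finset V, ∀ μ : I → ℤ, y (μ + ∑ v ∈ F, a v) F ≠ 0 →
      μ ∈ Finset.univ.biUnion fun G : Finset V =>
        (z G).coeff.support.image fun x => x + ∑ v ∈ G, a v - ∑ v ∈ F, a v := by
    intro F μ hμ
    have : ∃ G, (z G).coeff (μ + ∑ v ∈ F, a v - ∑ v ∈ G, a v) ≠ 0 := by
      by_contra! h
      exact hμ (congrFun (hy0 _ h) F)
    obtain ⟨G, hG⟩ := this
    refine Finset.mem_biUnion.2 ⟨G, Finset.mem_univ _, Finset.mem_image.2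
      ⟨_, Finsupp.mem_support_iff.2 hG, ?_⟩⟩
    abel
  set Y : Finset V → AddMonoidAlgebra k (I → ℤ) := fun F =>
    AddMonoidAlgebra.ofCoeff (Finsupp.onFinset _ (fun μ => y (μ + ∑ v ∈ F, a v) F) (hfin F))
    with hY
  have hYc : ∀ F μ, (Y F).coeff μ = y (μ + ∑ v ∈ F, a v) F := fun F μ => rfl
  refine ⟨Y, fun F => mem_conePiece.2 fun μ hμ => ?_, ?_⟩
  · rw [hYc] at hμ
    simpa using hy _ F hμ
  · funext G
    ext μ
    have h1 := coeff_koszulBoundary_single (a := a) Y (μ + ∑ v ∈ G, a v) G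
    have h2 := congrFun (hyz (μ + ∑ v ∈ G, a v)) G
    simp only [hYc, sub_add_cancel] at h1
    rw [add_sub_cancel_right] at h1 h2
    exact h1.trans h2

end ConeAlgebra

section Polytope

variable {n : ℕ}

/-- The homogeneous coordinates of `u`. -/
def homogenize (u : Fin n → ℤ) : Option (Fin n) → ℤ := fun o => o.elim 1 u

/-- The embedding of `ℤⁿ × ℤ` for which the last coordinate is rescaled by `d`. -/
def scaledEmbedding (n d : ℕ) : (Fin n → ℤ) × ℤ →+ (Option (Fin n) → ℤ) where
  toFun p o := o.elim (d * p.2) p.1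
  map_zero' := by
    funext o
    cases o <;> simp
  map_add' p q := by
    funext o
    cases o <;> simp [mul_add]

theorem scaledEmbedding_none (d : ℕ) (p : (Fin n → ℤ) × ℤ) :
    scaledEmbedding n d p none = d * p.2 := rfl

theorem scaledEmbedding_injective {d : ℕ} (hd : 1 ≤ d) :
    Function.Injective (scaledEmbedding n d) := by
  intro p q h
  refine Prod.ext (funext fun i => congrFun h (some i)) ?_
  have h1 : (d : ℤ) * p.2 = d * q.2 := congrFun h none
  exact mul_left_cancel₀ (by exact_mod_cast (by omega : d ≠ 0)) h1

variable {V : Type} [Fintype V] {I : Type} {a : V → I → ℤ} {i₀ : I}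

theorem InCone.exists_sub_of_height [Fintype I] (ha : ∀ v, a v i₀ = 1)
    {d e : ℕ} (hcard : Fintype.card I ≤ e ∨ Fintype.card V ≤ e)
    (hstrict : ∀ x, StrictCone a x → (e : ℤ) - d ≤ x i₀) (j : ℕ) :
    ∀ x : I → ℤ, InCone a x → x i₀ = d + j →
      ∃ y, InCone a y ∧ y i₀ = d ∧ InCone a (x - y) := by
  induction j with
  | zero =>
    intro x hx h
    exact ⟨x, hx, by simpa using h, by rw [sub_self]; exact inCone_zero⟩
  | succ j ih =>
    intro x hx h
    push_cast at h
    obtain ⟨v, hv⟩ := hx.exists_sub ha hcard hstrict (by omega)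
    obtain ⟨y, hy, hyd, hxy⟩ := ih _ hv (by rw [Pi.sub_apply, ha]; omega)
    refine ⟨y, hy, hyd, ?_⟩
    have := hxy.add (inCone_generator v)
    rwa [show x - a v - y + a v = x - y by abel] at this

theorem exists_mem_polytopeSemigroup {u : V → Fin n → ℤ} {d e : ℕ}
    (hcard : n + 1 ≤ e ∨ Fintype.card V ≤ e)
    (hstrict : ∀ x, StrictCone (fun v => homogenize (u v)) x → (e : ℤ) - d ≤ x none)
    {Q : Set (Fin n → ℝ)} (hQ : ∀ x : Fin n → ℤ, (fun i => (x i : ℝ)) ∈ Q ↔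
      InCone (fun v => homogenize (u v)) (scaledEmbedding n d (x, 1))) (ℓ : ℕ) :
    ∀ x, InCone (fun v => homogenize (u v)) x → x none = ((d * ℓ : ℕ) : ℤ) →
      ∃ q ∈ polytopeSemigroup n Q, q.2 = ℓ ∧ scaledEmbedding n d q = x := by
  have ha : ∀ v, homogenize (u v) none = 1 := fun v => rfl
  induction ℓ with
  | zero =>
    intro x hx h
    exact ⟨0, AddSubmonoid.zero_mem _, rfl, by rw [map_zero, hx.eq_zero ha (by simpa using h)]⟩
  | succ ℓ ih =>
    intro x hx h
    obtain ⟨y, hy, hyd, hxy⟩ := InCone.exists_sub_of_height ha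
      (by rwa [Fintype.card_option, Fintype.card_fin]) hstrict (d * ℓ) x hx
      (by rw [h]; push_cast; ring)
    obtain ⟨q, hq, hq2, hqx⟩ := ih _ hxy (by rw [Pi.sub_apply, h, hyd]; push_cast; ring)
    have hy1 : scaledEmbedding n d (fun i => y (some i), 1) = y := by
      funext o
      cases o with
      | none => rw [scaledEmbedding_none, hyd, mul_one]
      | some i => rfl
    refine ⟨(fun i => y (some i), 1) + q, AddSubmonoid.add_mem _ (AddSubmonoid.subset_closure
      ⟨(hQ _).2 (hy1 ▸ hy), rfl⟩) hq, ?_, ?_⟩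
    · rw [Prod.snd_add, hq2]
      push_cast
      ring
    · rw [map_add, hy1, hqx, add_sub_cancel]

theorem inCone_of_mem_polytopeSemigroup {u : V → Fin n → ℤ} {d : ℕ}
    {Q : Set (Fin n → ℝ)} (hQ : ∀ x : Fin n → ℤ, (fun i => (x i : ℝ)) ∈ Q ↔
      InCone (fun v => homogenize (u v)) (scaledEmbedding n d (x, 1)))
    {q : (Fin n → ℤ) × ℤ} (hq : q ∈ polytopeSemigroup n Q) :
    0 ≤ q.2 ∧ InCone (fun v => homogenize (u v)) (scaledEmbedding n d q) := by
  induction hq using AddSubmonoid.closure_induction with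
  | mem q hq =>
    obtain ⟨x, h⟩ := q
    obtain ⟨hx, rfl⟩ := hq
    exact ⟨zero_le_one, (hQ x).1 hx⟩
  | zero => exact ⟨le_rfl, by rw [map_zero]; exact inCone_zero⟩
  | add p q _ _ hp hq => exact ⟨add_nonneg hp.1 hq.1, by rw [map_add]; exact hp.2.add hq.2⟩

theorem isKoszul_polytopeSemigroup (k : Type) [Field k] {u : V → Fin n → ℤ} {d e : ℕ}
    (hd : 1 ≤ d) (hcard : n + 1 ≤ e ∨ Fintype.card V ≤ e)
    (hstrict : ∀ x, StrictCone (fun v => homogenize (u v)) x → (e : ℤ) - d ≤ x none)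
    {Q : Set (Fin n → ℝ)} (hQ : ∀ x : Fin n → ℤ, (fun i => (x i : ℝ)) ∈ Q ↔
      InCone (fun v => homogenize (u v)) (scaledEmbedding n d (x, 1))) :
    IsKoszul (fun ℓ : ℕ => Submodule.span k {x : AddMonoidAlgebra k (polytopeSemigroup n Q) |
      ∃ s : polytopeSemigroup n Q,
        (s : (Fin n → ℤ) × ℤ).2 = ℓ ∧ x = AddMonoidAlgebra.single s 1}) := by
  classical
  let _ : LinearOrder V := LinearOrder.lift' _ (Fintype.equivFin V).injective
  have ha : ∀ v, homogenize (u v) none = 1 := fun v => rfl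
  have hcone := fun s : polytopeSemigroup n Q => inCone_of_mem_polytopeSemigroup hQ s.2
  let f : polytopeSemigroup n Q →+ ℕ :=
    { toFun := fun s => (s : (Fin n → ℤ) × ℤ).2.toNat
      map_zero' := rfl
      map_add' := fun s t => Int.toNat_add (hcone s).1 (hcone t).1 }
  have hf : ∀ (s : polytopeSemigroup n Q) (ℓ : ℕ),
      f s = ℓ ↔ (s : (Fin n → ℤ) × ℤ).2 = ℓ := fun s ℓ => by
    have := (hcone s).1
    change (s : (Fin n → ℤ) × ℤ).2.toNat = ℓ ↔ _
    omega
  have hgrade : (fun ℓ : ℕ => Submodule.span k {x : AddMonoidAlgebra k (polytopeSemigroup n Q) |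
      ∃ s : polytopeSemigroup n Q, (s : (Fin n → ℤ) × ℤ).2 = ℓ ∧
        x = AddMonoidAlgebra.single s 1}) = AddMonoidAlgebra.gradeBy k f := by
    funext ℓ
    have h1 : AddMonoidAlgebra.gradeBy k f ℓ = AddMonoidAlgebra.supported k k {s | f s = ℓ} :=
      Submodule.ext fun x => Iff.rfl
    rw [h1, AddMonoidAlgebra.supported_eq_span_single]
    congr 1
    ext x
    constructor
    · rintro ⟨s, hs, rfl⟩
      exact ⟨s, (hf s ℓ).2 hs, rfl⟩
    · rintro ⟨s, hs, rfl⟩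
      exact ⟨s, (hf s ℓ).1 hs, rfl⟩
  have : GradedAlgebra (fun ℓ : ℕ => Submodule.span k
      {x : AddMonoidAlgebra k (polytopeSemigroup n Q) | ∃ s : polytopeSemigroup n Q,
        (s : (Fin n → ℤ) × ℤ).2 = ℓ ∧ x = AddMonoidAlgebra.single s 1}) := by
    rw [hgrade]
    exact AddMonoidAlgebra.gradeBy.gradedAlgebra f
  refine isKoszul_of_koszulRegular _
    (j := AddMonoidAlgebra.mapDomainAlgHom k k
      ((scaledEmbedding n d).comp (polytopeSemigroup n Q).subtype))
    (A := conePiece k (fun v => homogenize (u v)) none) (fun ℓ => ?_) hd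
    (AddMonoidAlgebra.mapDomain_injective
      ((scaledEmbedding_injective hd).comp Subtype.val_injective))
    (exists_algebraMap_of_mem_conePiece_zero ha) one_mem_conePiece
    (fun v => single_mem_conePiece (inCone_generator v) rfl 1) mul_mem_conePiece
    (koszulRegular_conePiece ha (by rwa [Fintype.card_option, Fintype.card_fin]) hstrict)
  rw [conePiece, AddMonoidAlgebra.supported_eq_span_single, Submodule.map_span]
  congr 1
  ext g
  constructor
  · rintro ⟨_, ⟨s, hs, rfl⟩, rfl⟩
    refine ⟨scaledEmbedding n d s, ⟨(hcone s).2, ?_⟩, ?_⟩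
    · rw [scaledEmbedding_none, hs]
      push_cast
      rfl
    · symm
      exact AddMonoidAlgebra.mapDomain_single
  · rintro ⟨x, ⟨hx, hxd⟩, rfl⟩
    obtain ⟨q, hq, hq2, rfl⟩ := exists_mem_polytopeSemigroup hcard hstrict hQ ℓ x hx hxd
    exact ⟨_, ⟨⟨q, hq⟩, hq2, rfl⟩, AddMonoidAlgebra.mapDomain_single⟩

end Polytope

section LatticePolytope

variable {n : ℕ} {V : Type} [Fintype V]

theorem mem_convexHull_range_iff {E : Type*} [AddCommGroup E] [Module ℝ E] {z : V → E} {x : E} :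
    x ∈ convexHull ℝ (Set.range z) ↔
      ∃ c : V → ℝ, 0 ≤ c ∧ ∑ v, c v = 1 ∧ ∑ v, c v • z v = x := by
  classical
  constructor
  · intro hx
    have h : convexHull ℝ (Set.range z) ⊆ Fintype.linearCombination ℝ z '' stdSimplex ℝ V := by
      refine convexHull_min ?_ ((convex_stdSimplex ℝ V).linear_image _)
      rintro _ ⟨v, rfl⟩
      exact ⟨Pi.single v 1, single_mem_stdSimplex ℝ v, by simp⟩
    obtain ⟨c, ⟨hc0, hc1⟩, rfl⟩ := h hx
    exact ⟨c, hc0, hc1, rfl⟩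
  · rintro ⟨c, hc0, hc1, rfl⟩
    exact mem_convexHull_of_exists_fintype c z hc0 hc1 (fun v => ⟨v, rfl⟩) rfl

theorem mem_smul_convexHull_range_iff {E : Type*} [AddCommGroup E] [Module ℝ E] {z : V → E}
    {x : E} {m : ℝ} (hm : 0 < m) :
    x ∈ m • convexHull ℝ (Set.range z) ↔
      ∃ c : V → ℝ, 0 ≤ c ∧ ∑ v, c v = m ∧ ∑ v, c v • z v = x := by
  rw [Set.mem_smul_set_iff_inv_smul_mem₀ hm.ne', mem_convexHull_range_iff]
  constructor
  · rintro ⟨c, hc0, hc1, hcx⟩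
    refine ⟨m • c, smul_nonneg hm.le hc0, ?_, ?_⟩
    · simp [← Finset.mul_sum, hc1]
    · simp only [Pi.smul_apply, smul_assoc]
      rw [← Finset.smul_sum, hcx, smul_inv_smul₀ hm.ne']
  · rintro ⟨c, hc0, hc1, rfl⟩
    refine ⟨m⁻¹ • c, smul_nonneg (inv_nonneg.2 hm.le) hc0, ?_, ?_⟩
    · simp [← Finset.mul_sum, hc1, hm.ne']
    · simp only [Pi.smul_apply, smul_assoc, Finset.smul_sum]

/-- A combination with positive coefficients of total weight `m` of the points spanning a
full-dimensional polytope `P` lies in the interior of `m • P`. -/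
theorem sum_smul_mem_interior {z : V → Fin n → ℝ}
    (hdim : (interior (convexHull ℝ (Set.range z))).Nonempty) {m : ℝ} (hm : 0 < m) {c : V → ℝ}
    (hc : ∀ v, 0 < c v) (hcm : ∑ v, c v = m) :
    ∑ v, c v • z v ∈ interior (m • convexHull ℝ (Set.range z)) := by
  obtain ⟨p, hp⟩ := hdim
  obtain ⟨b, hb0, hb1, hbp⟩ := mem_convexHull_range_iff.1 (interior_subset hp)
  have : Nonempty V := by
    by_contra h
    rw [not_nonempty_iff] at h
    simp at hb1
  obtain ⟨v₀, hv₀⟩ := Finite.exists_min c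
  have hv₀m : c v₀ ≤ m := hcm ▸ Finset.single_le_sum (fun v _ => (hc v).le) (Finset.mem_univ v₀)
  have hb1' : ∀ v, b v ≤ 1 := fun v =>
    hb1 ▸ Finset.single_le_sum (fun v _ => hb0 v) (Finset.mem_univ v)
  set s : ℝ := c v₀ / (2 * m) with hs
  have hs0 : 0 < s := div_pos (hc v₀) (by positivity)
  have hsm : s * m = c v₀ / 2 := by rw [hs]; field_simp
  have hs1 : 0 < 1 - s := by
    have : s ≤ 1 / 2 := by rw [hs, div_le_div_iff₀ (by positivity) two_pos]; linarith
    linarith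
  have hq : ∑ v, ((1 - s)⁻¹ * (c v - s * m * b v)) • z v ∈ m • convexHull ℝ (Set.range z) := by
    refine (mem_smul_convexHull_range_iff hm).2 ⟨_, fun v => ?_, ?_, rfl⟩
    · refine mul_nonneg (inv_nonneg.2 hs1.le) ?_
      rw [hsm]
      have h1 := mul_le_mul_of_nonneg_left (hb1' v) (half_pos (hc v₀)).le
      linarith [hv₀ v, hc v₀]
    · rw [← Finset.mul_sum, Finset.sum_sub_distrib, ← Finset.mul_sum, hb1, hcm]
      field_simp
  have hp' : m • p ∈ interior (m • convexHull ℝ (Set.range z)) := by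
    rw [interior_smul₀ hm.ne']
    exact Set.smul_mem_smul_set hp
  have := ((convex_convexHull ℝ (Set.range z)).smul m).combo_interior_self_mem_interior hp' hq
    hs0 hs1.le (by ring)
  convert this using 1
  rw [← hbp, Finset.smul_sum, Finset.smul_sum, Finset.smul_sum, ← Finset.sum_add_distrib]
  refine Finset.sum_congr rfl fun v _ => ?_
  simp only [smul_smul, ← add_smul]
  congr 1
  field_simp
  ring

variable {u : V → Fin n → ℤ}

theorem comb_homogenize_eq_iff {c : V → ℝ} {x : Option (Fin n) → ℤ} :
    comb (fun v => homogenize (u v)) c = (fun i => (x i : ℝ)) ↔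
      ∑ v, c v = x none ∧ ∑ v, c v • (fun i => (u v i : ℝ)) = fun i => (x (some i) : ℝ) := by
  constructor
  · intro h
    refine ⟨?_, funext fun i => ?_⟩
    · have := congrFun h none
      simpa [comb_apply, homogenize] using this
    · have := congrFun h (some i)
      simpa [comb_apply, homogenize] using this
  · rintro ⟨h0, h1⟩
    funext o
    cases o with
    | none => simpa [comb_apply, homogenize] using h0
    | some i =>
      have := congrFun h1 i
      simpa [comb_apply, homogenize] using this

theorem mem_smul_convexHull_iff_inCone {d : ℕ} (hd : 1 ≤ d) (x : Fin n → ℤ) :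
    (fun i => (x i : ℝ)) ∈
        (d : ℝ) • convexHull ℝ (Set.range fun (v : V) (i : Fin n) => (u v i : ℝ)) ↔
      InCone (fun v => homogenize (u v)) (scaledEmbedding n d (x, 1)) := by
  rw [mem_smul_convexHull_range_iff (by exact_mod_cast hd)]
  refine exists_congr fun c => and_congr_right fun _ => ?_
  rw [comb_homogenize_eq_iff, scaledEmbedding_none]
  push_cast
  rw [mul_one]
  rfl

/-- If the dilation `r • P` has no interior lattice point, then the interior lattice points of
the cone over `P` have height greater than `r`. -/
theorem StrictCone.lt_height {r : ℕ} (hr0 : 0 < r)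
    (hdim : (interior (convexHull ℝ
      (Set.range fun (v : V) (i : Fin n) => (u v i : ℝ)))).Nonempty)
    (hrno : ∀ x : Fin n → ℤ, (fun i => (x i : ℝ)) ∉
      interior ((r : ℝ) • convexHull ℝ (Set.range fun (v : V) (i : Fin n) => (u v i : ℝ))))
    {x : Option (Fin n) → ℤ} (hx : StrictCone (fun v => homogenize (u v)) x) :
    (r : ℤ) < x none := by
  classical
  by_contra! hle
  obtain ⟨v₀⟩ : Nonempty V := by
    obtain ⟨_, ⟨v, rfl⟩⟩ := convexHull_nonempty_iff.1 (hdim.mono interior_subset)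
    exact ⟨v⟩
  obtain ⟨c, hc, hcx⟩ := hx
  obtain ⟨h0, h1⟩ := comb_homogenize_eq_iff.1 hcx
  have hle' : (0 : ℝ) ≤ r - x none := sub_nonneg.2 (by exact_mod_cast hle)
  have hsingle : (0 : V → ℝ) ≤ Pi.single v₀ ((r : ℝ) - x none) := Pi.single_nonneg.2 hle'
  refine hrno (fun i => x (some i) + (r - x none) * u v₀ i) ?_
  have := sum_smul_mem_interior hdim (m := r) (by exact_mod_cast hr0)
    (c := c + Pi.single v₀ ((r : ℝ) - x none))
    (fun v => add_pos_of_pos_of_nonneg (hc v) (hsingle v))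
    (by simp [Finset.sum_add_distrib, h0])
  convert this using 1
  simp only [Pi.add_apply, add_smul, Finset.sum_add_distrib]
  rw [h1, Fintype.sum_eq_single v₀ fun v hv => by rw [Pi.single_eq_of_ne hv, zero_smul]]
  funext i
  simp

end LatticePolytope

/-- Let `P ⊆ ℝⁿ` be a lattice polytope of dimension `n` and `r` the largest positive
integer such that `rP` has no interior lattice points. Then the polytopal semigroup ring
`k[S_{(n-r)P}]`, graded by the last coordinate, is Koszul. -/
theorem stmt15 (k : Type) [Field k] (n : ℕ) (P : Set (Fin n → ℝ))
    (t : Finset (Fin n → ℤ))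
    (hP : P = convexHull ℝ ((fun (v : Fin n → ℤ) (i : Fin n) => ((v i : ℝ))) '' t))
    (hdim : (interior P).Nonempty)
    (r : ℕ) (hr0 : 0 < r)
    (hrno : ∀ x : Fin n → ℤ, (fun i => ((x i : ℝ))) ∉ interior ((r : ℝ) • P))
    (hrmax : ∀ m : ℕ, r < m → ∃ x : Fin n → ℤ,
      (fun i => ((x i : ℝ))) ∈ interior ((m : ℝ) • P)) :
    IsKoszul (fun ℓ : ℕ =>
      Submodule.span k {x : AddMonoidAlgebra k (polytopeSemigroup n (((n - r : ℕ) : ℝ) • P)) |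
        ∃ s : polytopeSemigroup n (((n - r : ℕ) : ℝ) • P),
          (s : (Fin n → ℤ) × ℤ).2 = ℓ ∧ x = AddMonoidAlgebra.single s 1}) := by
  rcases Nat.eq_zero_or_pos (n - r) with hd | hd
  · have hP0 : P.Nonempty := hdim.mono interior_subset
    have hsum : ∀ {c : Unit → ℝ} {x : Option (Fin n) → ℤ},
        comb (fun _ : Unit => homogenize (0 : Fin n → ℤ)) c = (fun i => (x i : ℝ)) →
          c () = x none ∧ ∀ i, x (some i) = 0 := fun {c x} hcx => by
      obtain ⟨h0, h1⟩ := comb_homogenize_eq_iff.1 hcx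
      refine ⟨by simpa using h0, fun i => ?_⟩
      have := congrFun h1 i
      have h2 : (0 : ℝ) = x (some i) := by simpa using this
      exact_mod_cast h2.symm
    refine isKoszul_polytopeSemigroup k (u := fun _ : Unit => (0 : Fin n → ℤ)) (d := 1) (e := 1)
      le_rfl (Or.inr (by simp)) (fun x hx => ?_) (fun x => ?_)
    · obtain ⟨c, hc, hcx⟩ := hx
      have : (0 : ℝ) < x none := (hsum hcx).1 ▸ hc ()
      have : 0 < x none := by exact_mod_cast this
      omega
    · rw [hd, Nat.cast_zero, Set.zero_smul_set hP0, Set.mem_zero]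
      constructor
      · intro hx
        have hx0 : x = 0 := funext fun i => by simpa using congrFun hx i
        refine ⟨fun _ => 1, fun _ => zero_le_one, comb_homogenize_eq_iff.2 ⟨?_, ?_⟩⟩
        · simp [scaledEmbedding_none]
        · funext i
          simp [hx0, scaledEmbedding]
      · rintro ⟨c, -, hcx⟩
        funext i
        have : x i = 0 := (hsum hcx).2 i
        simp [this]
  · have hP' : P = convexHull ℝ (Set.range fun (v : t) (i : Fin n) => (v.1 i : ℝ)) := by
      rw [hP, Set.image_eq_range]
      rfl
    subst hP'
    refine isKoszul_polytopeSemigroup k (u := fun v : t => v.1) (d := n - r) (e := n + 1)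
      hd (Or.inl le_rfl) (fun x hx => ?_) (mem_smul_convexHull_iff_inCone hd)
    have := hx.lt_height hr0 hdim hrno
    omega
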